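/- Gelation for the modified Smoluchowski equation: let c₀ : S → [0,∞) satisfy 0 < ⟨c₀,a⟩ < ∞ and ⟨c₀,m⟩ < ∞, set m₁ = ⟨c₀,a⟩, m₂ = ⟨c₀,a(a−1)⟩ ∈ [0,∞], and define T_gel = −log(1 − m₁/m₂) if m₂ > m₁ and T_gel = +∞ otherwise. Then the unique solution (cₜ) of the modified Smoluchowski equation with limited aggregations with initial condition c₀ satisfies: (1) t ↦ ⟨cₜ,m⟩ is continuous on [0,∞), is constant on [0,T_gel], and, when T_gel < ∞, is strictly decreasing on [T_gel,∞); (2) t ↦ Aₜ = ⟨cₜ,a⟩ is continuous, strictly decreasing, and strictly positive on [0,∞). -/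

import Mathlib

open Set MeasureTheory intervalIntegral ENNReal

/-- Total concentration of arms ⟨c,a⟩ = ∑_{(a,m) ∈ S} a · c(a,m). -/
noncomputable def armSum (c : ℕ → ℕ → ℝ) : ℝ := ∑' p : ℕ × ℕ, (p.1 : ℝ) * c p.1 p.2

/-- Total mass ⟨c,m⟩ = ∑_{(a,m) ∈ S} m · c(a,m). -/
noncomputable def massSum (c : ℕ → ℕ → ℝ) : ℝ := ∑' p : ℕ × ℕ, (p.2 : ℝ) * c p.1 p.2

/-- Second factorial arm moment ⟨c,a(a-1)⟩, with values in [0,∞]. -/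
noncomputable def armSum2 (c : ℕ → ℕ → ℝ) : ℝ≥0∞ :=
  ∑' p : ℕ × ℕ, ENNReal.ofReal ((p.1 : ℝ) * ((p.1 : ℝ) - 1) * c p.1 p.2)

/-- Gelation time T_gel ∈ [0,∞]: −log(1 − m₁/m₂) if m₂ > m₁, and +∞ otherwise. -/
noncomputable def TgelSmolu (c₀ : ℕ → ℕ → ℝ) : ℝ≥0∞ :=
  if ENNReal.ofReal (armSum c₀) < armSum2 c₀ then
    ENNReal.ofReal (- Real.log (1 - armSum c₀ / (armSum2 c₀).toReal))
  else ⊤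

/-- Gain term (with its 1/2 factor). -/
noncomputable def coagGain (c : ℕ → ℕ → ℝ) (a m : ℕ) : ℝ :=
  (1 / 2) * ∑ a' ∈ Finset.range (a + 2), ∑ m' ∈ Finset.Ico 1 m,
    ((a' : ℝ) * ((a + 2 - a' : ℕ) : ℝ)) * c a' m' * c (a + 2 - a') (m - m')

/-- Loss term. -/
noncomputable def coagLoss (c : ℕ → ℕ → ℝ) (a m : ℕ) : ℝ :=
  ∑' p' : ℕ × ℕ, ((a : ℝ) * (p'.1 : ℝ)) * c a m * c p'.1 p'.2

/-- Solution of the modified Smoluchowski equation with limited aggregations. -/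
def IsModifiedSmoluchowskiSolution (c : ℝ → ℕ → ℕ → ℝ) (c₀ : ℕ → ℕ → ℝ) : Prop :=
  (∀ t ∈ Ici (0:ℝ), ∀ a m : ℕ, 0 ≤ c t a m) ∧
  (∀ t ∈ Ici (0:ℝ), ∀ a : ℕ, c t a 0 = 0) ∧
  (∀ a m : ℕ, ContinuousOn (fun t => c t a m) (Ici 0)) ∧
  ∀ t ∈ Ici (0:ℝ),
    (0 < sInf ((fun s => armSum (c s)) '' Icc 0 t)) ∧
    BddAbove ((fun s => armSum (c s)) '' Icc 0 t) ∧
    IntervalIntegrable (fun s => (armSum (c s)) ^ 2) volume 0 t ∧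
    ∀ a m : ℕ, 1 ≤ m →
      c t a m - c₀ a m =
        ∫ s in (0:ℝ)..t, (armSum (c s))⁻¹ * (coagGain (c s) a m - coagLoss (c s) a m)

open Filter Topology

/-- The power series `∑ pₖ xᵏ`. -/
noncomputable def powSum (p : ℕ → ℝ) (x : ℝ) : ℝ := ∑' k, p k * x ^ k

section PowSum

variable {p : ℕ → ℝ}

lemma summable_mul_pow_of_mem_Icc (hp : ∀ k, 0 ≤ p k) (hs : Summable p) {x : ℝ}
    (hx : x ∈ Icc (0 : ℝ) 1) : Summable fun k => p k * x ^ k :=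
  Summable.of_nonneg_of_le (fun k => mul_nonneg (hp k) (pow_nonneg hx.1 k))
    (fun k => mul_le_of_le_one_right (hp k) (pow_le_one₀ hx.1 hx.2)) hs

lemma powSum_one : powSum p 1 = ∑' k, p k := by simp [powSum]

lemma powSum_nonneg (hp : ∀ k, 0 ≤ p k) {x : ℝ} (hx : 0 ≤ x) : 0 ≤ powSum p x :=
  tsum_nonneg fun k => mul_nonneg (hp k) (pow_nonneg hx k)

lemma powSum_monotoneOn (hp : ∀ k, 0 ≤ p k) (hs : Summable p) :
    MonotoneOn (powSum p) (Icc 0 1) := fun x hx y hy hxy =>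
  (summable_mul_pow_of_mem_Icc hp hs hx).tsum_le_tsum
    (fun k => mul_le_mul_of_nonneg_left (pow_le_pow_left₀ hx.1 hxy k) (hp k))
    (summable_mul_pow_of_mem_Icc hp hs hy)

lemma powSum_strictMonoOn (hp : ∀ k, 0 ≤ p k) (hs : Summable p) {k : ℕ} (hk : k ≠ 0)
    (hpk : 0 < p k) : StrictMonoOn (powSum p) (Icc 0 1) := fun x hx y hy hxy =>
  (summable_mul_pow_of_mem_Icc hp hs hx).tsum_lt_tsum (i := k)
    (fun k => mul_le_mul_of_nonneg_left (pow_le_pow_left₀ hx.1 hxy.le k) (hp k))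
    (mul_lt_mul_of_pos_left (pow_lt_pow_left₀ hxy hx.1 hk) hpk)
    (summable_mul_pow_of_mem_Icc hp hs hy)

lemma continuousOn_powSum (hp : ∀ k, 0 ≤ p k) (hs : Summable p) :
    ContinuousOn (powSum p) (Icc 0 1) := by
  refine continuousOn_tsum (u := p) (fun k => by fun_prop) hs fun k x hx => ?_
  rw [Real.norm_of_nonneg (mul_nonneg (hp k) (pow_nonneg hx.1 k))]
  exact mul_le_of_le_one_right (hp k) (pow_le_one₀ hx.1 hx.2)

lemma convexOn_powSum (hp : ∀ k, 0 ≤ p k) (hs : Summable p) :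
    ConvexOn ℝ (Icc 0 1) (powSum p) := by
  refine ⟨convex_Icc 0 1, fun x hx y hy a b ha hb hab => ?_⟩
  have hz := convex_Icc (0 : ℝ) 1 hx hy ha hb hab
  have sx := (summable_mul_pow_of_mem_Icc hp hs hx).mul_left a
  have sy := (summable_mul_pow_of_mem_Icc hp hs hy).mul_left b
  simp only [powSum, smul_eq_mul] at hz ⊢
  rw [← tsum_mul_left, ← tsum_mul_left, ← sx.tsum_add sy]
  refine (summable_mul_pow_of_mem_Icc hp hs hz).tsum_le_tsum (fun k => ?_) (sx.add sy)
  have := mul_le_mul_of_nonneg_left ((convexOn_pow k).2 hx.1 hy.1 ha hb hab) (hp k)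
  simp only [smul_eq_mul] at this
  linarith

lemma strictConvexOn_powSum (hp : ∀ k, 0 ≤ p k) (hs : Summable p) {n : ℕ} (hn : 2 ≤ n)
    (hpn : 0 < p n) : StrictConvexOn ℝ (Icc 0 1) (powSum p) := by
  refine ⟨convex_Icc 0 1, fun x hx y hy hxy a b ha hb hab => ?_⟩
  have hz := convex_Icc (0 : ℝ) 1 hx hy ha.le hb.le hab
  have sx := (summable_mul_pow_of_mem_Icc hp hs hx).mul_left a
  have sy := (summable_mul_pow_of_mem_Icc hp hs hy).mul_left b
  simp only [powSum, smul_eq_mul] at hz ⊢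
  rw [← tsum_mul_left, ← tsum_mul_left, ← sx.tsum_add sy]
  refine (summable_mul_pow_of_mem_Icc hp hs hz).tsum_lt_tsum (i := n) (fun k => ?_) ?_ (sx.add sy)
  · have := mul_le_mul_of_nonneg_left ((convexOn_pow k).2 hx.1 hy.1 ha.le hb.le hab) (hp k)
    simp only [smul_eq_mul] at this
    linarith
  · have := mul_lt_mul_of_pos_left ((strictConvexOn_pow hn).2 hx.1 hy.1 hxy ha hb hab) hpn
    simp only [smul_eq_mul] at this
    linarith

lemma exists_hasDerivAt_powSum (hp : ∀ k, 0 ≤ p k) (hs : Summable p) {x : ℝ}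
    (hx : x ∈ Ioo (0 : ℝ) 1) : ∃ g, HasDerivAt (powSum p) g x := by
  obtain ⟨r, hxr, hr⟩ := exists_between hx.2
  have hr0 : 0 < r := hx.1.trans hxr
  have hbd : ∀ k, p k ≤ ∑' k, p k := fun k => hs.le_tsum k fun j _ => hp j
  have hu : Summable fun k : ℕ => (∑' k, p k) * ((k : ℝ) * r ^ k / r) := by
    have := (summable_pow_mul_geometric_of_norm_lt_one (r := r) 1
      (by rwa [Real.norm_of_nonneg hr0.le]))
    simp only [pow_one] at this
    exact (this.div_const r).mul_left _
  refine ⟨_, hasDerivAt_tsum_of_isPreconnected (t := Ioo 0 r) (y₀ := x) (y := x)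
    (g := fun k y => p k * y ^ k) (g' := fun k y => p k * (k * y ^ (k - 1))) hu isOpen_Ioo
    isPreconnected_Ioo (fun k y _ => (hasDerivAt_pow k y).const_mul _) (fun k y hy => ?_)
    ⟨hx.1, hxr⟩ (summable_mul_pow_of_mem_Icc hp hs ⟨hx.1.le, hx.2.le⟩) ⟨hx.1, hxr⟩⟩
  have h1 : 0 ≤ y ^ (k - 1) := pow_nonneg hy.1.le _
  rw [Real.norm_of_nonneg (mul_nonneg (hp k) (by positivity))]
  rcases Nat.eq_zero_or_pos k with rfl | hk
  · simp
  have h2 : r ^ k / r = r ^ (k - 1) := by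
    rw [div_eq_iff hr0.ne', ← pow_succ, Nat.sub_add_cancel hk]
  rw [mul_div_assoc, h2]
  have h3 : y ^ (k - 1) ≤ r ^ (k - 1) := pow_le_pow_left₀ hy.1.le hy.2.le _
  have h4 : (0 : ℝ) ≤ k * y ^ (k - 1) := by positivity
  exact mul_le_mul (hbd k) (by gcongr) h4 (tsum_nonneg hp)

lemma powSum_one_sub_le (hp : ∀ k, 0 ≤ p k) (hs : Summable p)
    (h2 : Summable fun k : ℕ => (k : ℝ) * p k) {x : ℝ} (hx : x ∈ Icc (0 : ℝ) 1) :
    powSum p 1 - powSum p x ≤ (1 - x) * ∑' k : ℕ, (k : ℝ) * p k := by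
  have h1 := summable_mul_pow_of_mem_Icc hp hs (x := 1) ⟨zero_le_one, le_rfl⟩
  have h3 := summable_mul_pow_of_mem_Icc hp hs hx
  rw [powSum, powSum, ← h1.tsum_sub h3, ← tsum_mul_left]
  refine (h1.sub h3).tsum_le_tsum (fun k => ?_) (h2.mul_left _)
  have := one_add_mul_le_pow (a := x - 1) (by linarith [hx.1]) k
  have h4 : 1 + (x - 1) = x := by ring
  rw [h4] at this
  have := mul_le_mul_of_nonneg_left this (hp k)
  simp only [one_pow]
  nlinarith

lemma summable_and_tsum_le_of_powSum_one_sub_le (hp : ∀ k, 0 ≤ p k) (hs : Summable p) {C : ℝ}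
    (h : ∀ x ∈ Ioo (0 : ℝ) 1, powSum p 1 - powSum p x ≤ C * (1 - x)) :
    (Summable fun k : ℕ => (k : ℝ) * p k) ∧ ∑' k : ℕ, (k : ℝ) * p k ≤ C := by
  have h0 : ∀ k : ℕ, 0 ≤ (k : ℝ) * p k := fun k => mul_nonneg k.cast_nonneg (hp k)
  have key : ∀ s : Finset ℕ, ∑ k ∈ s, (k : ℝ) * p k ≤ C := by
    intro s
    have hx : ∀ x ∈ Ioo (0 : ℝ) 1, ∑ k ∈ s, p k * ∑ j ∈ Finset.range k, x ^ j ≤ C := by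
      intro x hx
      have hx' : x ∈ Icc (0 : ℝ) 1 := ⟨hx.1.le, hx.2.le⟩
      have h1 := summable_mul_pow_of_mem_Icc hp hs (x := 1) ⟨zero_le_one, le_rfl⟩
      have h3 := summable_mul_pow_of_mem_Icc hp hs hx'
      have h4 : ∑ k ∈ s, (p k * 1 ^ k - p k * x ^ k) ≤ powSum p 1 - powSum p x := by
        rw [powSum, powSum, ← h1.tsum_sub h3]
        refine (h1.sub h3).sum_le_tsum s fun k _ => ?_
        have := mul_le_of_le_one_right (hp k) (pow_le_one₀ (n := k) hx'.1 hx'.2)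
        simpa using this
      have h5 : ∑ k ∈ s, (p k * 1 ^ k - p k * x ^ k)
          = (∑ k ∈ s, p k * ∑ j ∈ Finset.range k, x ^ j) * (1 - x) := by
        rw [Finset.sum_mul]
        refine Finset.sum_congr rfl fun k _ => ?_
        have := geom_sum_mul x k
        have h6 : (∑ j ∈ Finset.range k, x ^ j) * (1 - x) = 1 - x ^ k := by linarith
        rw [mul_assoc, h6, one_pow]; ring
      rw [h5] at h4
      exact le_of_mul_le_mul_right (h4.trans (h x hx)) (by linarith [hx.2])
    have hc : Tendsto (fun x : ℝ => ∑ k ∈ s, p k * ∑ j ∈ Finset.range k, x ^ j) (𝓝[<] 1)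
        (𝓝 (∑ k ∈ s, p k * ∑ j ∈ Finset.range k, (1 : ℝ) ^ j)) :=
      (Continuous.tendsto (by fun_prop) 1).mono_left nhdsWithin_le_nhds
    have := le_of_tendsto hc (by
      filter_upwards [Ioo_mem_nhdsLT (zero_lt_one (α := ℝ))] with x hx' using hx x hx')
    simpa [mul_comm] using this
  exact ⟨summable_of_sum_le h0 key, Real.tsum_le_of_sum_le h0 key⟩

end PowSum

/-- The relations satisfied by the foot `ℓ t` of the characteristic ending at the boundary of the
disc of convergence at time `t`. -/
structure GelationProfile (p : ℕ → ℝ) (w ℓ α : ℝ → ℝ) : Prop where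
  coeff_nonneg : ∀ k, 0 ≤ p k
  coeff_summable : Summable p
  w_pos : ∀ t, 0 ≤ t → 0 < w t
  w_anti : ∀ s t, 0 ≤ s → s ≤ t → w t ≤ w s
  w_eq : ∀ t, 0 ≤ t → w t = powSum p (ℓ t)
  foot_eq : ∀ t, 0 ≤ t → ℓ t = Real.exp (-t) + α t * w t
  foot_le_one : ∀ t, 0 ≤ t → ℓ t ≤ 1
  clock_zero : α 0 = 0
  le_clock_sub : ∀ s t, 0 ≤ s → s ≤ t → Real.exp (-s) - Real.exp (-t) ≤ (α t - α s) * w s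
  clock_sub_le : ∀ s t, 0 ≤ s → s ≤ t → (α t - α s) * w t ≤ Real.exp (-s) - Real.exp (-t)
  lt_of_lt_foot : ∀ t, 0 ≤ t → ∀ x, 0 ≤ x → x < ℓ t → x - α t * powSum p x < Real.exp (-t)

namespace GelationProfile

variable {p : ℕ → ℝ} {w ℓ α : ℝ → ℝ}

lemma clock_mono (h : GelationProfile p w ℓ α) {s t : ℝ} (hs : 0 ≤ s) (hst : s ≤ t) :
    α s ≤ α t := by
  have h1 := h.le_clock_sub s t hs hst
  have h2 : Real.exp (-t) ≤ Real.exp (-s) := Real.exp_le_exp.2 (by linarith)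
  have := nonneg_of_mul_nonneg_left (by linarith : 0 ≤ (α t - α s) * w s) (h.w_pos s hs)
  linarith

lemma clock_lt (h : GelationProfile p w ℓ α) {s t : ℝ} (hs : 0 ≤ s) (hst : s < t) :
    α s < α t := by
  have h1 := h.le_clock_sub s t hs hst.le
  have h2 : Real.exp (-t) < Real.exp (-s) := Real.exp_lt_exp.2 (by linarith)
  have := pos_of_mul_pos_left (by linarith : 0 < (α t - α s) * w s) (h.w_pos s hs).le
  linarith

lemma clock_nonneg (h : GelationProfile p w ℓ α) {t : ℝ} (ht : 0 ≤ t) : 0 ≤ α t := by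
  simpa [h.clock_zero] using h.clock_mono le_rfl ht

lemma foot_pos (h : GelationProfile p w ℓ α) {t : ℝ} (ht : 0 ≤ t) : 0 < ℓ t := by
  rw [h.foot_eq t ht]
  have := mul_nonneg (h.clock_nonneg ht) (h.w_pos t ht).le
  have := Real.exp_pos (-t)
  linarith

lemma foot_mem (h : GelationProfile p w ℓ α) {t : ℝ} (ht : 0 ≤ t) : ℓ t ∈ Icc (0 : ℝ) 1 :=
  ⟨(h.foot_pos ht).le, h.foot_le_one t ht⟩

lemma foot_zero (h : GelationProfile p w ℓ α) : ℓ 0 = 1 := by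
  simp [h.foot_eq 0 le_rfl, h.clock_zero]

lemma w_zero (h : GelationProfile p w ℓ α) : w 0 = powSum p 1 := by
  rw [h.w_eq 0 le_rfl, h.foot_zero]

lemma foot_sub_le (h : GelationProfile p w ℓ α) {s t : ℝ} (hs : 0 ≤ s) (hst : s ≤ t) :
    ℓ s - ℓ t ≤ α t * (powSum p (ℓ s) - powSum p (ℓ t)) := by
  have h1 := h.le_clock_sub s t hs hst
  have h2 := h.foot_eq s hs
  have h3 := h.foot_eq t (hs.trans hst)
  rw [← h.w_eq s hs, ← h.w_eq t (hs.trans hst)]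
  nlinarith

lemma le_foot_sub (h : GelationProfile p w ℓ α) {s t : ℝ} (hs : 0 ≤ s) (hst : s ≤ t) :
    Real.exp (-t) ≤ ℓ t - α s * powSum p (ℓ t) := by
  have h3 := h.foot_eq t (hs.trans hst)
  rw [← h.w_eq t (hs.trans hst), h3]
  have := mul_le_mul_of_nonneg_right (h.clock_mono hs hst) (h.w_pos t (hs.trans hst)).le
  linarith

lemma one_sub_foot_le (h : GelationProfile p w ℓ α) {t : ℝ} (ht : 0 ≤ t) :
    1 - ℓ t ≤ α t * (powSum p 1 - powSum p (ℓ t)) := by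
  simpa [h.foot_zero] using h.foot_sub_le le_rfl ht

lemma phase_foot (h : GelationProfile p w ℓ α) {t : ℝ} (ht : 0 ≤ t) :
    ℓ t - α t * powSum p (ℓ t) = Real.exp (-t) := by
  rw [← h.w_eq t ht, h.foot_eq t ht]; ring

lemma phase_lt (h : GelationProfile p w ℓ α) {t : ℝ} (ht : 0 ≤ t) {x y : ℝ} (hx : 0 ≤ x)
    (hxy : x < y) (hy : y ≤ ℓ t) : x - α t * powSum p x < y - α t * powSum p y := by
  have hl := h.lt_of_lt_foot t ht x hx (hxy.trans_le hy)
  rcases hy.eq_or_lt with rfl | hy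
  · rwa [h.phase_foot ht]
  have hd : 0 < ℓ t - x := by linarith
  obtain ⟨a, b, ha, hb, hab, rfl⟩ : ∃ a b : ℝ, 0 ≤ a ∧ 0 < b ∧ a + b = 1 ∧ y = a * x + b * ℓ t :=
    ⟨(ℓ t - y) / (ℓ t - x), (y - x) / (ℓ t - x), div_nonneg (by linarith) hd.le,
      div_pos (by linarith) hd, by field_simp; ring, by field_simp; ring⟩
  have hm := h.foot_mem ht
  have hc := (convexOn_powSum h.coeff_nonneg h.coeff_summable).2
    (x := x) (y := ℓ t) ⟨hx, by linarith [hm.2]⟩ hm ha hb.le hab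
  simp only [smul_eq_mul] at hc
  have h1 := mul_le_mul_of_nonneg_left hc (h.clock_nonneg ht)
  have h2 := h.phase_foot ht
  have h3 := mul_lt_mul_of_pos_left hl hb
  have h4 : a = 1 - b := by linarith
  rw [← h2] at h3
  subst h4
  nlinarith

lemma phase_le (h : GelationProfile p w ℓ α) {t : ℝ} (ht : 0 ≤ t) {x y : ℝ} (hx : 0 ≤ x)
    (hxy : x ≤ y) (hy : y ≤ ℓ t) : x - α t * powSum p x ≤ y - α t * powSum p y := by
  rcases hxy.eq_or_lt with rfl | hxy
  · rfl
  · exact (h.phase_lt ht hx hxy hy).le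

lemma foot_eq_one_of_affine (h : GelationProfile p w ℓ α) (hp : ∀ k, 2 ≤ k → p k = 0) {t : ℝ}
    (ht : 0 ≤ t) : ℓ t = 1 := by
  have hG : ∀ x, powSum p x = p 0 + p 1 * x := by
    intro x
    rw [powSum, tsum_eq_sum (s := Finset.range 2)]
    · simp [Finset.sum_range_succ]
    · intro k hk
      rw [hp k (by simpa [Nat.lt_iff_add_one_le] using hk), zero_mul]
  have h1 := h.one_sub_foot_le ht
  have h2 := h.phase_foot ht
  rw [hG] at h1 h2
  rw [hG] at h1
  have h3 := h.foot_pos ht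
  have h4 := Real.exp_pos (-t)
  have h5 := mul_nonneg (h.clock_nonneg ht) (h.coeff_nonneg 0)
  have h6 : 0 < 1 - α t * p 1 := by
    refine pos_of_mul_pos_right (a := ℓ t) ?_ h3.le
    nlinarith
  have h7 := h.foot_le_one t ht
  by_contra hne
  have h8 : 0 < 1 - ℓ t := by
    rcases h7.eq_or_lt with h | h
    · exact absurd h hne
    · linarith
  have := mul_pos h8 h6
  nlinarith

lemma foot_anti (h : GelationProfile p w ℓ α) {s t : ℝ} (hs : 0 ≤ s) (hst : s ≤ t) :
    ℓ t ≤ ℓ s := by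
  by_cases hp : ∀ k, 2 ≤ k → p k = 0
  · rw [h.foot_eq_one_of_affine hp hs, h.foot_eq_one_of_affine hp (hs.trans hst)]
  push Not at hp
  obtain ⟨k, hk, hpk⟩ := hp
  by_contra! hlt
  have := powSum_strictMonoOn h.coeff_nonneg h.coeff_summable (by omega : k ≠ 0)
    ((h.coeff_nonneg k).lt_of_ne' hpk) (h.foot_mem hs) (h.foot_mem (hs.trans hst)) hlt
  rw [← h.w_eq s hs, ← h.w_eq t (hs.trans hst)] at this
  linarith [h.w_anti s t hs hst]

lemma continuousWithinAt_clock_Iio (h : GelationProfile p w ℓ α) {t : ℝ} (ht : 0 < t) :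
    Tendsto α (𝓝[<] t) (𝓝 (α t)) := by
  have hw := h.w_pos t ht.le
  have h1 : Tendsto (fun s => α t - (Real.exp (-s) - Real.exp (-t)) / w t) (𝓝[<] t) (𝓝 (α t)) := by
    have : Tendsto (fun s => α t - (Real.exp (-s) - Real.exp (-t)) / w t) (𝓝 t)
        (𝓝 (α t - (Real.exp (-t) - Real.exp (-t)) / w t)) :=
      Continuous.tendsto (by fun_prop) t
    simp only [sub_self, zero_div, sub_zero] at this
    exact this.mono_left nhdsWithin_le_nhds
  refine tendsto_of_tendsto_of_tendsto_of_le_of_le' h1 tendsto_const_nhds ?_ ?_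
  · filter_upwards [Ioo_mem_nhdsLT ht] with s hs
    have := (le_div_iff₀ hw).2 (h.clock_sub_le s t hs.1.le hs.2.le)
    linarith
  · filter_upwards [Ioo_mem_nhdsLT ht] with s hs using h.clock_mono hs.1.le hs.2.le

lemma tendsto_foot_Ioi (h : GelationProfile p w ℓ α) {s : ℝ} (hs : 0 ≤ s) :
    Tendsto ℓ (𝓝[>] s) (𝓝 (ℓ s)) := by
  refine tendsto_order.2 ⟨fun x hx => ?_, fun x hx => ?_⟩
  · have hx' : max x 0 < ℓ s := max_lt hx (h.foot_pos hs)
    have h1 := h.lt_of_lt_foot s hs _ (le_max_right x 0) hx'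
    have h2 : Tendsto (fun t : ℝ => Real.exp (-t)) (𝓝[>] s) (𝓝 (Real.exp (-s))) :=
      (Continuous.tendsto (by fun_prop) s).mono_left nhdsWithin_le_nhds
    filter_upwards [h2.eventually (lt_mem_nhds h1), self_mem_nhdsWithin] with t ht hst
    have hst' : s < t := hst
    by_contra! hle
    have h3 := h.phase_le hs (h.foot_pos (hs.trans hst'.le)).le (hle.trans (le_max_left x 0)) hx'.le
    linarith [h.le_foot_sub hs hst'.le]
  · filter_upwards [self_mem_nhdsWithin] with t ht
    exact (h.foot_anti hs (le_of_lt ht)).trans_lt hx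

lemma tendsto_foot_Iio (h : GelationProfile p w ℓ α) {t : ℝ} (ht : 0 < t) :
    Tendsto ℓ (𝓝[<] t) (𝓝 (ℓ t)) := by
  by_cases hp : ∀ k, 2 ≤ k → p k = 0
  · rw [h.foot_eq_one_of_affine hp ht.le]
    refine tendsto_const_nhds.congr' ?_
    filter_upwards [Ioo_mem_nhdsLT ht] with s hs using (h.foot_eq_one_of_affine hp hs.1.le).symm
  push Not at hp
  obtain ⟨n, hn, hpn⟩ := hp
  refine tendsto_order.2 ⟨fun x hx => ?_, fun y hy => ?_⟩
  · filter_upwards [Ioo_mem_nhdsLT ht] with s hs using hx.trans_le (h.foot_anti hs.1.le hs.2.le)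
  by_contra hcon
  have hys : ∀ s ∈ Ioo 0 t, y ≤ ℓ s := by
    intro s hs
    by_contra! hlt
    refine hcon ?_
    filter_upwards [Ioo_mem_nhdsLT hs.2] with r hr
    exact (h.foot_anti hs.1.le hr.1.le).trans_lt hlt
  have hy1 : y ≤ 1 := by
    obtain ⟨s, hs⟩ := exists_between ht
    exact (hys s hs).trans (h.foot_le_one s hs.1.le)
  have hl := h.foot_pos ht.le
  have hphase : ∀ x ∈ Ioc (ℓ t) y, x - α t * powSum p x = Real.exp (-t) := by
    intro x hx
    have h1 : Tendsto (fun s => x - α s * powSum p x) (𝓝[<] t) (𝓝 (x - α t * powSum p x)) :=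
      ((h.continuousWithinAt_clock_Iio ht).mul_const _).const_sub _
    have h2 : Tendsto (fun t : ℝ => Real.exp (-t)) (𝓝[<] t) (𝓝 (Real.exp (-t))) :=
      (Continuous.tendsto (by fun_prop) t).mono_left nhdsWithin_le_nhds
    refine le_antisymm (le_of_tendsto_of_tendsto h1 h2 ?_) (ge_of_tendsto h1 ?_)
    · filter_upwards [Ioo_mem_nhdsLT ht] with s hs
      rw [← h.phase_foot hs.1.le]
      exact h.phase_le hs.1.le (hl.trans hx.1).le (hx.2.trans (hys s hs)) le_rfl
    · filter_upwards [Ioo_mem_nhdsLT ht] with s hs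
      exact (h.le_foot_sub hs.1.le hs.2.le).trans
        (h.phase_le hs.1.le hl.le hx.1.le (hx.2.trans (hys s hs)))
  have e1 := h.phase_foot ht.le
  have e2 := hphase y ⟨hy, le_rfl⟩
  have e3 := hphase ((1 / 2) * ℓ t + (1 / 2) * y) ⟨by linarith, by linarith⟩
  have hsc := (strictConvexOn_powSum h.coeff_nonneg h.coeff_summable hn
    ((h.coeff_nonneg n).lt_of_ne' hpn)).2 (h.foot_mem ht.le) ⟨(hl.trans hy).le, hy1⟩ hy.ne
    (by norm_num : (0 : ℝ) < 1 / 2) (by norm_num : (0 : ℝ) < 1 / 2) (by norm_num)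
  simp only [smul_eq_mul] at hsc
  have hα : 0 < α t := by simpa [h.clock_zero] using h.clock_lt le_rfl ht
  have := mul_lt_mul_of_pos_left hsc hα
  linarith

lemma continuousOn_foot (h : GelationProfile p w ℓ α) : ContinuousOn ℓ (Ici 0) := by
  intro t ht
  rcases eq_or_lt_of_le (mem_Ici.1 ht) with rfl | h0
  · exact continuousWithinAt_Ioi_iff_Ici.1 (h.tendsto_foot_Ioi le_rfl)
  · refine ContinuousAt.continuousWithinAt (continuousAt_iff_continuous_left'_right'.2
      ⟨h.tendsto_foot_Iio h0, h.tendsto_foot_Ioi h0.le⟩)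

/-- Before gelation the foot of the boundary characteristic stays at `1`. -/
lemma foot_eq_one (h : GelationProfile p w ℓ α) {t : ℝ} (ht : 0 ≤ t)
    (h2 : Summable fun k : ℕ => (k : ℝ) * p k)
    (hsub : (∑' k : ℕ, (k : ℝ) * p k) * (1 - Real.exp (-t)) ≤ ∑' k, p k) : ℓ t = 1 := by
  by_contra hne
  set m₂ := ∑' k : ℕ, (k : ℝ) * p k with hm₂
  have hm₂0 : 0 ≤ m₂ := tsum_nonneg fun k => mul_nonneg k.cast_nonneg (h.coeff_nonneg k)
  set S := Icc 0 t ∩ ℓ ⁻¹' {1} with hS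
  have hSc : IsClosed S :=
    (h.continuousOn_foot.mono Icc_subset_Ici_self).preimage_isClosed_of_isClosed isClosed_Icc
      isClosed_singleton
  have hSne : S.Nonempty := ⟨0, ⟨le_rfl, ht⟩, h.foot_zero⟩
  have hSb : BddAbove S := ⟨t, fun r hr => hr.1.2⟩
  obtain ⟨⟨h0, h0t⟩, hl0⟩ := hSc.csSup_mem hSne hSb
  set r₀ := sSup S
  have hl0 : ℓ r₀ = 1 := hl0
  have hr₀t : r₀ < t := by
    rcases h0t.eq_or_lt with h' | h'
    · exact absurd (h' ▸ hl0) hne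
    · exact h'
  have hα0 : α r₀ * powSum p 1 = 1 - Real.exp (-r₀) := by
    have := h.phase_foot h0
    rw [hl0] at this
    linarith
  have hstep : ∀ r ∈ Ioc r₀ t, 1 ≤ α r * m₂ := by
    intro r hr
    have hr0 : 0 ≤ r := h0.trans hr.1.le
    have hlt : ℓ r < 1 := by
      refine lt_of_le_of_ne (h.foot_le_one r hr0) fun h1 => ?_
      exact absurd (le_csSup hSb ⟨⟨hr0, hr.2⟩, h1⟩) (not_le.2 hr.1)
    have h3 := h.one_sub_foot_le hr0
    have h4 := mul_le_mul_of_nonneg_left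
      (powSum_one_sub_le h.coeff_nonneg h.coeff_summable h2 (h.foot_mem hr0)) (h.clock_nonneg hr0)
    have h5 : (1 - ℓ r) * 1 ≤ (1 - ℓ r) * (α r * m₂) := by nlinarith
    exact le_of_mul_le_mul_left h5 (by linarith)
  have hwt := h.w_pos t ht
  have hlim : 1 ≤ α r₀ * m₂ := by
    have h6 : Tendsto (fun r => (α r₀ + (Real.exp (-r₀) - Real.exp (-r)) / w t) * m₂) (𝓝[>] r₀)
        (𝓝 ((α r₀ + (Real.exp (-r₀) - Real.exp (-r₀)) / w t) * m₂)) :=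
      (Continuous.tendsto (by fun_prop) r₀).mono_left nhdsWithin_le_nhds
    simp only [sub_self, zero_div, add_zero] at h6
    refine ge_of_tendsto h6 ?_
    filter_upwards [Ioc_mem_nhdsGT hr₀t] with r hr
    refine (hstep r hr).trans (mul_le_mul_of_nonneg_right ?_ hm₂0)
    have h7 := h.clock_sub_le r₀ r h0 hr.1.le
    have h8 := mul_le_mul_of_nonneg_left (h.w_anti r t (h0.trans hr.1.le) hr.2)
      (sub_nonneg.2 (h.clock_mono h0 hr.1.le))
    have := (le_div_iff₀ hwt).2 (h8.trans h7)
    linarith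
  have hp1 : 0 < powSum p 1 := h.w_zero ▸ h.w_pos 0 le_rfl
  rw [← powSum_one] at hsub
  have hm₂pos : 0 < m₂ := by
    refine hm₂0.lt_of_ne fun h' => ?_
    rw [← h'] at hlim
    linarith
  have hexp : Real.exp (-t) < Real.exp (-r₀) := Real.exp_lt_exp.2 (by linarith)
  have h9 := mul_le_mul_of_nonneg_right hlim hp1.le
  have h10 : α r₀ * m₂ * powSum p 1 = m₂ * (1 - Real.exp (-r₀)) := by rw [← hα0]; ring
  have := mul_lt_mul_of_pos_left hexp hm₂pos
  nlinarith

/-- If the foot stalls at a value, no gelation has happened yet. -/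
lemma subcritical_of_foot_eq (h : GelationProfile p w ℓ α) {s t : ℝ} (hs : 0 ≤ s) (hst : s < t)
    (heq : ℓ s = ℓ t) : (Summable fun k : ℕ => (k : ℝ) * p k) ∧
      (∑' k : ℕ, (k : ℝ) * p k) * (1 - Real.exp (-t)) ≤ ∑' k, p k := by
  have ht : 0 ≤ t := hs.trans hst.le
  have hα : 0 < α t := by simpa [h.clock_zero] using h.clock_lt le_rfl (hs.trans_lt hst)
  have hlow : ∀ x, 0 ≤ x → x < ℓ t → α t * (powSum p (ℓ t) - powSum p x) < ℓ t - x := by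
    intro x hx hxl
    have h1 := h.phase_foot ht
    have h2 := h.lt_of_lt_foot t ht x hx hxl
    linarith
  rcases (h.foot_le_one t ht).eq_or_lt with hl1 | hl1
  · have hα1 : α t * powSum p 1 = 1 - Real.exp (-t) := by
      have := h.phase_foot ht
      rw [hl1] at this
      linarith
    obtain ⟨h1, h2⟩ := summable_and_tsum_le_of_powSum_one_sub_le h.coeff_nonneg h.coeff_summable
      (C := (α t)⁻¹) (fun x hx => by
        have := hlow x hx.1.le (hl1 ▸ hx.2)
        rw [hl1] at this
        rw [inv_mul_eq_div, le_div_iff₀ hα]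
        linarith)
    refine ⟨h1, ?_⟩
    have hz : 0 ≤ 1 - Real.exp (-t) := by
      have := Real.exp_le_one_iff.2 (by linarith : -t ≤ 0)
      linarith
    refine (mul_le_mul_of_nonneg_right h2 hz).trans ?_
    rw [← hα1, ← powSum_one, inv_mul_cancel_left₀ hα.ne']
  exfalso
  have hl0 := h.foot_pos ht
  obtain ⟨g, hg⟩ := exists_hasDerivAt_powSum h.coeff_nonneg h.coeff_summable ⟨hl0, hl1⟩
  have hup : ∀ y ∈ Ioo (ℓ t) 1, y - ℓ t ≤ α s * (powSum p y - powSum p (ℓ t)) := by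
    intro y hy
    have hivt := intermediate_value_Icc' hs (h.continuousOn_foot.mono Icc_subset_Ici_self)
    have hmem : y ∈ Icc (ℓ s) (ℓ 0) := by rw [heq, h.foot_zero]; exact ⟨hy.1.le, hy.2.le⟩
    obtain ⟨r, hr, hry⟩ := hivt hmem
    have := h.foot_sub_le hr.1 hr.2
    rwa [heq, hry] at this
  have h1 : 1 ≤ α s * g := by
    have htd := (hasDerivAt_iff_tendsto_slope.1 hg).mono_left
      (nhdsWithin_mono _ (fun y (hy : y ∈ Ioi (ℓ t)) => (ne_of_gt hy : y ≠ ℓ t)))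
    refine ge_of_tendsto (htd.const_mul (α s)) ?_
    filter_upwards [Ioo_mem_nhdsGT hl1] with y hy
    rw [slope_def_field, ← mul_div_assoc, le_div_iff₀ (by linarith [hy.1])]
    linarith [hup y hy]
  have h2 : α t * g ≤ 1 := by
    have htd := (hasDerivAt_iff_tendsto_slope.1 hg).mono_left
      (nhdsWithin_mono _ (fun y (hy : y ∈ Iio (ℓ t)) => (ne_of_lt hy : y ≠ ℓ t)))
    refine le_of_tendsto (htd.const_mul (α t)) ?_
    filter_upwards [Ioo_mem_nhdsLT hl0] with y hy
    rw [slope_comm, slope_def_field, ← mul_div_assoc, div_le_iff₀ (by linarith [hy.2])]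
    linarith [hlow y hy.1.le hy.2]
  have h3 : 0 < g := by
    by_contra! hg0
    have := mul_nonpos_of_nonneg_of_nonpos (h.clock_nonneg hs) hg0
    linarith
  have := mul_lt_mul_of_pos_right (h.clock_lt hs hst) h3
  linarith

end GelationProfile

section Transport

lemma summable_succ_sq_mul_geometric {q : ℝ} (hq0 : 0 ≤ q) (hq1 : q < 1) :
    Summable fun a : ℕ => ((a : ℝ) + 1) ^ 2 * q ^ a := by
  have h := fun n => summable_pow_mul_geometric_of_norm_lt_one (r := q) n
    (by rwa [Real.norm_of_nonneg hq0])
  refine (((h 2).add ((h 1).mul_left 2)).add (h 0)).congr fun a => ?_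
  ring

/-- Coefficients of the product of `∑ P_j xʲ` with the derivative of `∑ e_i xⁱ`. -/
noncomputable def transportConv (e P : ℕ → ℝ) (a : ℕ) : ℝ :=
  ∑ ij ∈ Finset.HasAntidiagonal.antidiagonal a, (((ij.1 : ℝ) + 1) * e (ij.1 + 1)) * P ij.2

lemma transportConv_nonneg {e P : ℕ → ℝ} (he : ∀ a, 0 ≤ e a) (hP : ∀ a, 0 ≤ P a) (a : ℕ) :
    0 ≤ transportConv e P a :=
  Finset.sum_nonneg fun ij _ => mul_nonneg (mul_nonneg (by positivity) (he _)) (hP _)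

variable {e P : ℕ → ℝ} {z Z q B : ℝ}

lemma succ_mul_pow_le (he : ∀ a, 0 ≤ e a) (heb : ∀ a, e a * Z ^ a ≤ B * q ^ a)
    (hz : 0 < z) (hzZ : z ≤ Z) (hB : 0 ≤ B) (hq0 : 0 ≤ q) (hq1 : q ≤ 1) (i : ℕ) :
    (((i : ℝ) + 1) * e (i + 1)) * Z ^ i ≤ (i + 1) * (B * q ^ i / z) := by
  have hZ : 0 < Z := hz.trans_le hzZ
  have h1 : e (i + 1) * Z ^ i ≤ B * q ^ i / z := by
    rw [le_div_iff₀ hz]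
    calc e (i + 1) * Z ^ i * z ≤ e (i + 1) * Z ^ i * Z :=
          mul_le_mul_of_nonneg_left hzZ (mul_nonneg (he _) (by positivity))
      _ = e (i + 1) * Z ^ (i + 1) := by ring
      _ ≤ B * q ^ (i + 1) := heb _
      _ ≤ B * q ^ i := mul_le_mul_of_nonneg_left (pow_le_pow_of_le_one hq0 hq1 (Nat.le_succ i)) hB
  rw [mul_assoc]
  exact mul_le_mul_of_nonneg_left h1 (by positivity)

lemma summable_succ_mul_pow (he : ∀ a, 0 ≤ e a) (heb : ∀ a, e a * Z ^ a ≤ B * q ^ a)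
    (hz : 0 < z) (hzZ : z ≤ Z) (hB : 0 ≤ B) (hq0 : 0 ≤ q) (hq1 : q < 1) :
    Summable fun i : ℕ => (((i : ℝ) + 1) * e (i + 1)) * Z ^ i := by
  have hZ : 0 < Z := hz.trans_le hzZ
  refine Summable.of_nonneg_of_le (fun i => ?_) (fun i => ?_)
    ((summable_succ_sq_mul_geometric hq0 hq1).mul_left (B / z))
  · exact mul_nonneg (mul_nonneg (by positivity) (he _)) (by positivity)
  · refine (succ_mul_pow_le he heb hz hzZ hB hq0 hq1.le i).trans ?_
    have h1 : (0 : ℝ) ≤ B / z * q ^ i := by positivity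
    have h2 : (i : ℝ) + 1 ≤ ((i : ℝ) + 1) ^ 2 := by nlinarith [(i.cast_nonneg : (0 : ℝ) ≤ i)]
    calc ((i : ℝ) + 1) * (B * q ^ i / z) = ((i : ℝ) + 1) * (B / z * q ^ i) := by ring
      _ ≤ ((i : ℝ) + 1) ^ 2 * (B / z * q ^ i) := mul_le_mul_of_nonneg_right h2 h1
      _ = _ := by ring

lemma summable_mul_pow_of_le (he : ∀ a, 0 ≤ e a) (heb : ∀ a, e a * Z ^ a ≤ B * q ^ a)
    (hZ : 0 ≤ Z) (hq0 : 0 ≤ q) (hq1 : q < 1) : Summable fun i : ℕ => e i * Z ^ i :=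
  Summable.of_nonneg_of_le (fun i => mul_nonneg (he i) (pow_nonneg hZ i)) heb
    ((summable_geometric_of_lt_one hq0 hq1).mul_left B)

lemma transportConv_mul_pow (e P : ℕ → ℝ) (Z : ℝ) (a : ℕ) : transportConv e P a * Z ^ a =
    ∑ ij ∈ Finset.HasAntidiagonal.antidiagonal a,
      ((((ij.1 : ℝ) + 1) * e (ij.1 + 1)) * Z ^ ij.1) * (P ij.2 * Z ^ ij.2) := by
  rw [transportConv, Finset.sum_mul]
  refine Finset.sum_congr rfl fun ij hij => ?_
  rw [← Finset.HasAntidiagonal.mem_antidiagonal.1 hij, pow_add]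
  ring

lemma transportConv_mul_pow_le (he : ∀ a, 0 ≤ e a) (heb : ∀ a, e a * Z ^ a ≤ B * q ^ a)
    (hP : ∀ a, 0 ≤ P a) (hPb : ∀ a, P a * Z ^ a ≤ B * q ^ a)
    (hz : 0 < z) (hzZ : z ≤ Z) (hB : 0 ≤ B) (hq0 : 0 ≤ q) (hq1 : q ≤ 1) (a : ℕ) :
    transportConv e P a * Z ^ a ≤ B ^ 2 / z * (((a : ℝ) + 1) ^ 2 * q ^ a) := by
  have hZ : 0 < Z := hz.trans_le hzZ
  rw [transportConv_mul_pow]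
  calc _ ≤ ∑ ij ∈ Finset.HasAntidiagonal.antidiagonal a, ((a : ℝ) + 1) * (B ^ 2 / z * q ^ a) := by
        refine Finset.sum_le_sum fun ij hij => ?_
        have hij := Finset.HasAntidiagonal.mem_antidiagonal.1 hij
        have h1 := succ_mul_pow_le he heb hz hzZ hB hq0 hq1 ij.1
        have h2 : (ij.1 : ℝ) + 1 ≤ a + 1 := by
          have : (ij.1 : ℝ) ≤ a := by exact_mod_cast (by omega : ij.1 ≤ a)
          linarith
        calc _ ≤ (((ij.1 : ℝ) + 1) * (B * q ^ ij.1 / z)) * (B * q ^ ij.2) :=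
              mul_le_mul h1 (hPb _) (mul_nonneg (hP _) (by positivity)) (by positivity)
          _ = ((ij.1 : ℝ) + 1) * (B ^ 2 / z * q ^ a) := by rw [← hij, pow_add]; ring
          _ ≤ _ := mul_le_mul_of_nonneg_right h2 (by positivity)
    _ = _ := by
        rw [Finset.sum_const, Finset.Nat.card_antidiagonal, nsmul_eq_mul]
        push_cast; ring

lemma hasSum_transportConv_mul_pow (he : ∀ a, 0 ≤ e a) (heb : ∀ a, e a * Z ^ a ≤ B * q ^ a)
    (hP : ∀ a, 0 ≤ P a) (hPb : ∀ a, P a * Z ^ a ≤ B * q ^ a)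
    (hz : 0 < z) (hzZ : z ≤ Z) (hB : 0 ≤ B) (hq0 : 0 ≤ q) (hq1 : q < 1) :
    HasSum (fun a => transportConv e P a * Z ^ a)
      ((∑' i : ℕ, (((i : ℝ) + 1) * e (i + 1)) * Z ^ i) * powSum P Z) := by
  have hZ : 0 < Z := hz.trans_le hzZ
  have h1 := summable_succ_mul_pow he heb hz hzZ hB hq0 hq1
  have h2 := summable_mul_pow_of_le hP hPb hZ.le hq0 hq1
  simp only [transportConv_mul_pow, powSum]
  rw [tsum_mul_tsum_eq_tsum_sum_antidiagonal_of_summable_norm h1.norm h2.norm]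
  exact (summable_norm_sum_mul_antidiagonal_of_summable_norm h1.norm h2.norm).of_norm.hasSum

/-- Differentiation of a power series with transported coefficients along a straight line. -/
lemma hasDerivAt_powSum_line {e P r : ℝ → ℕ → ℝ} {z w τ₁ q B : ℝ}
    (hz : 0 < z) (hw : 0 ≤ w) (hB : 0 ≤ B) (hq0 : 0 ≤ q) (hq1 : q < 1)
    (he : ∀ τ ∈ Ioo 0 τ₁, ∀ a, 0 ≤ e τ a)
    (heb : ∀ τ ∈ Ioo 0 τ₁, ∀ a, e τ a * (z + (τ₁ - τ) * w) ^ a ≤ B * q ^ a)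
    (hP : ∀ τ ∈ Ioo 0 τ₁, ∀ a, 0 ≤ P τ a)
    (hPb : ∀ τ ∈ Ioo 0 τ₁, ∀ a, P τ a * (z + (τ₁ - τ) * w) ^ a ≤ B * q ^ a)
    (hr0 : ∀ τ ∈ Ioo 0 τ₁, ∀ a, 0 ≤ r τ a)
    (hr : ∀ τ ∈ Ioo 0 τ₁, ∀ a, r τ a ≤ transportConv (e τ) (P τ) a)
    (hd : ∀ τ ∈ Ioo 0 τ₁, ∀ a, HasDerivAt (fun τ => e τ a) (r τ a) τ) {τ : ℝ}
    (hτ : τ ∈ Ioo 0 τ₁) :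
    HasDerivAt (fun τ => powSum (e τ) (z + (τ₁ - τ) * w))
      (powSum (r τ) (z + (τ₁ - τ) * w) -
        w * ∑' i : ℕ, (((i : ℝ) + 1) * e τ (i + 1)) * (z + (τ₁ - τ) * w) ^ i) τ := by
  set Z : ℝ → ℝ := fun τ => z + (τ₁ - τ) * w with hZdef
  have hzZ : ∀ τ ∈ Ioo 0 τ₁, z ≤ Z τ := fun τ hτ => by
    have := mul_nonneg (sub_nonneg.2 hτ.2.le) hw
    simp only [hZdef]; linarith
  have hZ0 : ∀ τ ∈ Ioo 0 τ₁, 0 < Z τ := fun τ hτ => hz.trans_le (hzZ τ hτ)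
  have hZd : ∀ τ, HasDerivAt Z (-w) τ := fun τ => by
    exact ((((hasDerivAt_id τ).const_sub τ₁).mul_const w).const_add z).congr_deriv (by ring)
  have hrb : ∀ τ ∈ Ioo 0 τ₁, ∀ a, r τ a * Z τ ^ a ≤ B ^ 2 / z * (((a : ℝ) + 1) ^ 2 * q ^ a) :=
    fun τ hτ a => (mul_le_mul_of_nonneg_right (hr τ hτ a) (pow_nonneg (hZ0 τ hτ).le a)).trans
      (transportConv_mul_pow_le (he τ hτ) (heb τ hτ) (hP τ hτ) (hPb τ hτ) hz (hzZ τ hτ) hB hq0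
        hq1.le a)
  have heb' : ∀ τ ∈ Ioo 0 τ₁, ∀ a : ℕ,
      e τ a * (a * Z τ ^ (a - 1)) ≤ B / z * (((a : ℝ) + 1) ^ 2 * q ^ a) := by
    intro τ hτ a
    rcases a with _ | i
    · simp only [CharP.cast_eq_zero, zero_mul, mul_zero]; positivity
    have h1 := mul_le_mul_of_nonneg_left (hzZ τ hτ)
      (mul_nonneg (he τ hτ (i + 1)) (pow_nonneg (hZ0 τ hτ).le i))
    have h2 := heb τ hτ (i + 1)
    have h3 : e τ (i + 1) * Z τ ^ i ≤ B / z * q ^ (i + 1) := by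
      rw [div_mul_eq_mul_div, le_div_iff₀ hz]
      exact h1.trans (le_of_eq_of_le (by ring) h2)
    have h4 : (0 : ℝ) ≤ B / z * q ^ (i + 1) := by positivity
    have h5 : ((i + 1 : ℕ) : ℝ) ≤ (((i + 1 : ℕ) : ℝ) + 1) ^ 2 := by
      have : (0 : ℝ) ≤ ((i + 1 : ℕ) : ℝ) := Nat.cast_nonneg _
      nlinarith
    calc e τ (i + 1) * (((i + 1 : ℕ) : ℝ) * Z τ ^ (i + 1 - 1))
        = ((i + 1 : ℕ) : ℝ) * (e τ (i + 1) * Z τ ^ i) := by rw [Nat.add_sub_cancel]; ring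
      _ ≤ ((i + 1 : ℕ) : ℝ) * (B / z * q ^ (i + 1)) :=
          mul_le_mul_of_nonneg_left h3 (Nat.cast_nonneg _)
      _ ≤ (((i + 1 : ℕ) : ℝ) + 1) ^ 2 * (B / z * q ^ (i + 1)) := mul_le_mul_of_nonneg_right h5 h4
      _ = _ := by ring
  have hsum := summable_succ_sq_mul_geometric hq0 hq1
  have key := hasDerivAt_tsum_of_isPreconnected
    (u := fun a : ℕ => (B ^ 2 / z + w * (B / z)) * (((a : ℝ) + 1) ^ 2 * q ^ a))
    (g := fun a τ => e τ a * Z τ ^ a)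
    (g' := fun a τ => r τ a * Z τ ^ a + e τ a * (a * Z τ ^ (a - 1) * (-w)))
    (hsum.mul_left _) isOpen_Ioo isPreconnected_Ioo
    (fun a τ hτ => (hd τ hτ a).mul ((hZd τ).pow a)) (fun a τ hτ => ?_) hτ
    (summable_mul_pow_of_le (he τ hτ) (heb τ hτ) (hZ0 τ hτ).le hq0 hq1) hτ
  · refine key.congr_deriv ?_
    have hs1 : Summable fun a => r τ a * Z τ ^ a :=
      Summable.of_nonneg_of_le (fun a => mul_nonneg (hr0 τ hτ a) (pow_nonneg (hZ0 τ hτ).le a))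
        (hrb τ hτ) (hsum.mul_left _)
    have hs2 : Summable fun a : ℕ => e τ a * (a * Z τ ^ (a - 1)) :=
      Summable.of_nonneg_of_le (fun a => mul_nonneg (he τ hτ a)
        (mul_nonneg a.cast_nonneg (pow_nonneg (hZ0 τ hτ).le _))) (heb' τ hτ) (hsum.mul_left _)
    have hs3 : (∑' a : ℕ, e τ a * (a * Z τ ^ (a - 1))) =
        ∑' i : ℕ, (((i : ℝ) + 1) * e τ (i + 1)) * Z τ ^ i := by
      rw [hs2.tsum_eq_zero_add]
      simp only [CharP.cast_eq_zero, zero_mul, mul_zero, zero_add]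
      refine tsum_congr fun i => ?_
      rw [Nat.add_sub_cancel]; push_cast; ring
    have hs4 : (fun a : ℕ => e τ a * (a * Z τ ^ (a - 1) * (-w))) =
        fun a : ℕ => (e τ a * (a * Z τ ^ (a - 1))) * (-w) := by
      funext a; ring
    rw [hs1.tsum_add (hs4 ▸ hs2.mul_right (-w)), hs4, tsum_mul_right, hs3, powSum]
    ring
  · have hZp := (hZ0 τ hτ).le
    have h1 : 0 ≤ r τ a * Z τ ^ a := mul_nonneg (hr0 τ hτ a) (pow_nonneg hZp a)
    have h2 : 0 ≤ e τ a * (a * Z τ ^ (a - 1)) :=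
      mul_nonneg (he τ hτ a) (mul_nonneg a.cast_nonneg (pow_nonneg hZp _))
    have h3 := hrb τ hτ a
    have h4 := mul_le_mul_of_nonneg_left (heb' τ hτ a) hw
    have h5 := mul_nonneg hw h2
    rw [Real.norm_eq_abs, abs_le]
    constructor <;> nlinarith

lemma continuousOn_powSum_line {e : ℝ → ℕ → ℝ} {z w τ₁ q B : ℝ}
    (hz : 0 < z) (hw : 0 ≤ w) (hq0 : 0 ≤ q) (hq1 : q < 1)
    (he : ∀ τ ∈ Icc 0 τ₁, ∀ a, 0 ≤ e τ a)
    (heb : ∀ τ ∈ Icc 0 τ₁, ∀ a, e τ a * (z + (τ₁ - τ) * w) ^ a ≤ B * q ^ a)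
    (hc : ∀ a, ContinuousOn (fun τ => e τ a) (Icc 0 τ₁)) :
    ContinuousOn (fun τ => powSum (e τ) (z + (τ₁ - τ) * w)) (Icc 0 τ₁) := by
  refine continuousOn_tsum (u := fun a => B * q ^ a) (fun a => (hc a).mul (by fun_prop))
    ((summable_geometric_of_lt_one hq0 hq1).mul_left B) fun a τ hτ => ?_
  have hZ : 0 ≤ z + (τ₁ - τ) * w := by
    have := mul_nonneg (sub_nonneg.2 hτ.2) hw
    linarith
  rw [Real.norm_of_nonneg (mul_nonneg (he τ hτ a) (pow_nonneg hZ a))]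
  exact heb τ hτ a

/-- A function with a linear differential equation that vanishes at the right end vanishes. -/
lemma eq_zero_of_hasDerivAt_mul_self {u V : ℝ → ℝ} {b K : ℝ} (hb : 0 ≤ b)
    (hc : ContinuousOn u (Icc 0 b)) (hd : ∀ x ∈ Ioo 0 b, HasDerivAt u (V x * u x) x)
    (hV : ∀ x ∈ Ioo 0 b, |V x| ≤ K) (hub : u b = 0) : ∀ x ∈ Icc 0 b, u x = 0 := by
  have hmono : MonotoneOn (fun x => u x ^ 2 * Real.exp (2 * K * x)) (Icc 0 b) := by
    refine monotoneOn_of_hasDerivWithinAt_nonneg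
      (f' := fun x => (2 * u x * (V x * u x)) * Real.exp (2 * K * x)
        + u x ^ 2 * (Real.exp (2 * K * x) * (2 * K))) (convex_Icc 0 b)
      ((hc.pow 2).mul (by fun_prop)) (fun x hx => ?_) (fun x hx => ?_)
    · rw [interior_Icc] at hx
      have h1 := (hd x hx).pow 2
      have h2 : HasDerivAt (fun x => Real.exp (2 * K * x)) (Real.exp (2 * K * x) * (2 * K)) x := by
        simpa using ((hasDerivAt_id x).const_mul (2 * K)).exp
      refine (HasDerivAt.congr_deriv (h1.mul h2) ?_).hasDerivWithinAt
      simp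
    · rw [interior_Icc] at hx
      have h1 := (abs_le.1 (hV x hx)).1
      have h2 := Real.exp_pos (2 * K * x)
      have h3 : 0 ≤ (V x + K) * (2 * (u x ^ 2 * Real.exp (2 * K * x))) :=
        mul_nonneg (by linarith) (by positivity)
      linarith
  intro x hx
  have := hmono hx ⟨hb, le_rfl⟩ hx.2
  simp only [hub] at this
  have h2 := Real.exp_pos (2 * K * x)
  have h3 : u x ^ 2 ≤ 0 := by
    by_contra! h
    have := mul_pos h h2
    norm_num at *
    linarith
  exact pow_eq_zero_iff two_ne_zero |>.1 (le_antisymm h3 (sq_nonneg _))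

end Transport

section Flux

/-- Concentration of the arms of clusters with `i + 1` arms and mass `m`. -/
def armFlux (c : ℕ → ℕ → ℝ) (i m : ℕ) : ℝ := ((i : ℝ) + 1) * c (i + 1) m

variable {c : ℕ → ℕ → ℝ}

lemma armFlux_nonneg (hc : ∀ a m, 0 ≤ c a m) (i m : ℕ) : 0 ≤ armFlux c i m :=
  mul_nonneg (by positivity) (hc _ _)

lemma coagGain_eq_sum_antidiagonal (hc : ∀ a, c a 0 = 0) (a m : ℕ) :
    coagGain c a m = 1 / 2 * ∑ ij ∈ Finset.HasAntidiagonal.antidiagonal a,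
      ∑ kl ∈ Finset.HasAntidiagonal.antidiagonal m,
        armFlux c ij.1 kl.1 * armFlux c ij.2 kl.2 := by
  rw [coagGain, Finset.sum_range_succ', Finset.Nat.sum_antidiagonal_eq_sum_range_succ_mk]
  simp only [CharP.cast_eq_zero, zero_mul, Finset.sum_const_zero, add_zero, Nat.succ_eq_add_one]
  congr 1
  refine Finset.sum_congr rfl fun i hi => ?_
  have hi : i ≤ a := Nat.lt_succ_iff.1 (Finset.mem_range.1 hi)
  have h1 : a + 2 - (i + 1) = a - i + 1 := by omega
  rw [Finset.Nat.sum_antidiagonal_eq_sum_range_succ_mk, h1]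
  symm
  have hsub : Finset.Ico 1 m ⊆ Finset.range m.succ := fun k hk => by
    simp only [Finset.mem_Ico, Finset.mem_range] at *; omega
  rw [← Finset.sum_subset hsub]
  · refine Finset.sum_congr rfl fun k _ => ?_
    simp only [armFlux]; push_cast; ring
  · intro k hk hk'
    simp only [Finset.mem_Ico, Finset.mem_range, not_and, not_lt] at hk hk'
    rcases Nat.eq_zero_or_pos k with rfl | hk0
    · simp [armFlux, hc]
    · have : m - k = 0 := by have := hk' hk0; omega
      simp [armFlux, hc, this]

lemma coagGain_nonneg (hc : ∀ a m, 0 ≤ c a m) (a m : ℕ) : 0 ≤ coagGain c a m := by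
  refine mul_nonneg (by norm_num) (Finset.sum_nonneg fun a' _ => Finset.sum_nonneg fun m' _ => ?_)
  exact mul_nonneg (mul_nonneg (by positivity) (hc _ _)) (hc _ _)

lemma coagLoss_eq (c : ℕ → ℕ → ℝ) (a m : ℕ) : coagLoss c a m = a * c a m * armSum c := by
  rw [coagLoss, armSum, ← tsum_mul_left]
  exact tsum_congr fun p => by ring

lemma hasSum_armFlux (hs : Summable fun p : ℕ × ℕ => (p.1 : ℝ) * c p.1 p.2) :
    HasSum (fun p : ℕ × ℕ => armFlux c p.1 p.2) (armSum c) := by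
  have hinj : Function.Injective fun p : ℕ × ℕ => (p.1 + 1, p.2) := fun p p' h => by
    simp only [Prod.mk.injEq] at h
    exact Prod.ext (Nat.succ_injective h.1) h.2
  have := (hinj.hasSum_iff (f := fun p : ℕ × ℕ => (p.1 : ℝ) * c p.1 p.2) (a := armSum c) ?_).2
    hs.hasSum
  · refine this.congr_fun fun p => ?_
    simp [armFlux]
  · rintro ⟨a, m⟩ h
    rcases a with _ | i
    · simp
    · exact absurd ⟨(i, m), rfl⟩ h

/-- Rescaling the concentrations by powers of a constant. -/
lemma coagGain_pow_mul (c : ℕ → ℕ → ℝ) (x : ℝ) (a m : ℕ) :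
    coagGain (fun a m => x ^ a * c a m) a m = x ^ (a + 2) * coagGain c a m := by
  simp only [coagGain, Finset.mul_sum]
  refine Finset.sum_congr rfl fun a' ha' => Finset.sum_congr rfl fun m' _ => ?_
  have : x ^ (a + 2) = x ^ a' * x ^ (a + 2 - a') := by
    rw [← pow_add]; congr 1
    have := Finset.mem_range.1 ha'
    omega
  rw [this]; ring

/-- Truncated arm sums. -/
def armPartial (c : ℕ → ℕ → ℝ) (n : ℕ) : ℝ :=
  ∑ i ∈ Finset.range n, ∑ m ∈ Finset.range n, armFlux c i m

lemma tendsto_armPartial (hs : Summable fun p : ℕ × ℕ => (p.1 : ℝ) * c p.1 p.2) :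
    Tendsto (armPartial c) atTop (𝓝 (armSum c)) := by
  have h : Tendsto (fun n : ℕ => Finset.range n ×ˢ Finset.range n) atTop atTop :=
    tendsto_atTop_finset_of_monotone
      (fun n k hnk => Finset.product_subset_product (Finset.range_mono hnk)
        (Finset.range_mono hnk))
      fun x => ⟨x.1 + x.2 + 1, by
        simp only [Finset.mem_product, Finset.mem_range]; omega⟩
  refine ((hasSum_armFlux hs).comp h).congr fun n => ?_
  simp [armPartial, Finset.sum_product]

lemma armPartial_le (hc : ∀ a m, 0 ≤ c a m)
    (hs : Summable fun p : ℕ × ℕ => (p.1 : ℝ) * c p.1 p.2) (n : ℕ) :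
    armPartial c n ≤ armSum c := by
  rw [armPartial, ← Finset.sum_product']
  exact sum_le_hasSum _ (fun p _ => armFlux_nonneg hc p.1 p.2) (hasSum_armFlux hs)

lemma armPartial_nonneg (hc : ∀ a m, 0 ≤ c a m) (n : ℕ) : 0 ≤ armPartial c n :=
  Finset.sum_nonneg fun i _ => Finset.sum_nonneg fun m _ => armFlux_nonneg hc i m

/-- The tent function of height `n` on `[0, 2n]`. -/
def tent (n a : ℕ) : ℕ := min a (2 * n - a)

lemma tent_bracket (n i j : ℕ) (hi : i < 2 * n) (hj : j < 2 * n) :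
    (tent n (i + j) : ℝ) + (if i < n ∧ j < n then 2 else 0) ≤ tent n (i + 1) + tent n (j + 1) := by
  have : tent n (i + j) + (if i < n ∧ j < n then 2 else 0) ≤ tent n (i + 1) + tent n (j + 1) := by
    unfold tent
    split_ifs <;> omega
  split_ifs with h
  · rw [if_pos h] at this; exact_mod_cast this
  · rw [if_neg h] at this; exact_mod_cast this

lemma sum_range_sum_antidiagonal_le {F : ℕ × ℕ → ℝ} (hF : ∀ x, 0 ≤ F x) (n : ℕ) :
    ∑ m ∈ Finset.range n, ∑ kl ∈ Finset.HasAntidiagonal.antidiagonal m, F kl ≤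
      ∑ k ∈ Finset.range n, ∑ l ∈ Finset.range n, F (k, l) := by
  rw [← Finset.sum_product' (f := fun k l => F (k, l))]
  have h := Finset.sum_fiberwise_of_maps_to (g := fun x : ℕ × ℕ => x.1 + x.2)
    (s := (Finset.range n ×ˢ Finset.range n).filter fun x => x.1 + x.2 < n) (t := Finset.range n)
    (fun x hx => Finset.mem_range.2 (Finset.mem_filter.1 hx).2) F
  have h' : ∑ m ∈ Finset.range n, ∑ kl ∈ Finset.HasAntidiagonal.antidiagonal m, F kl =
      ∑ x ∈ (Finset.range n ×ˢ Finset.range n).filter (fun x => x.1 + x.2 < n), F x := by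
    rw [← h]
    refine Finset.sum_congr rfl fun m hm => Finset.sum_congr ?_ fun _ _ => rfl
    ext ⟨k, l⟩
    simp only [Finset.mem_range, Finset.HasAntidiagonal.mem_antidiagonal, Finset.mem_filter,
      Finset.mem_product] at *
    omega
  rw [h']
  exact Finset.sum_le_sum_of_subset_of_nonneg (Finset.filter_subset _ _) fun x _ _ => hF x

lemma sum_antidiagonal_mul_le {f g : ℕ → ℝ} (hf : ∀ k, 0 ≤ f k) (hg : ∀ k, 0 ≤ g k) (n : ℕ) :
    ∑ m ∈ Finset.range n, ∑ kl ∈ Finset.HasAntidiagonal.antidiagonal m, f kl.1 * g kl.2 ≤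
      (∑ k ∈ Finset.range n, f k) * ∑ l ∈ Finset.range n, g l := by
  rw [Finset.sum_mul_sum]
  exact sum_range_sum_antidiagonal_le (F := fun x => f x.1 * g x.2)
    (fun x => mul_nonneg (hf _) (hg _)) n

/-- Tested against the tent function, coagulation consumes at least the squared arm sum. -/
lemma sum_tent_mul_gain_le (hc : ∀ a m, 0 ≤ c a m) (hc0 : ∀ a, c a 0 = 0)
    (hs : Summable fun p : ℕ × ℕ => (p.1 : ℝ) * c p.1 p.2) (n : ℕ) :
    ∑ a ∈ Finset.range (2 * n), ∑ m ∈ Finset.range n,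
      (tent n a : ℝ) * (coagGain c a m - coagLoss c a m) ≤ - armPartial c n ^ 2 := by
  set P : ℕ → ℝ := fun i => ∑ m ∈ Finset.range n, armFlux c i m with hP
  have hP0 : ∀ i, 0 ≤ P i := fun i => Finset.sum_nonneg fun m _ => armFlux_nonneg hc i m
  have hgain : ∀ a, ∑ m ∈ Finset.range n, coagGain c a m ≤
      1 / 2 * ∑ ij ∈ Finset.HasAntidiagonal.antidiagonal a, P ij.1 * P ij.2 := by
    intro a
    simp only [coagGain_eq_sum_antidiagonal hc0, ← Finset.mul_sum]
    refine mul_le_mul_of_nonneg_left ?_ (by norm_num)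
    rw [Finset.sum_comm]
    exact Finset.sum_le_sum fun ij _ => sum_antidiagonal_mul_le (armFlux_nonneg hc ij.1)
      (armFlux_nonneg hc ij.2) n
  have hG : ∑ a ∈ Finset.range (2 * n), ∑ m ∈ Finset.range n, (tent n a : ℝ) * coagGain c a m ≤
      ∑ i ∈ Finset.range (2 * n), ∑ j ∈ Finset.range (2 * n),
        1 / 2 * ((tent n (i + j) : ℝ) * (P i * P j)) := by
    refine le_trans (Finset.sum_le_sum fun a _ => ?_) (sum_range_sum_antidiagonal_le
      (F := fun x => 1 / 2 * ((tent n (x.1 + x.2) : ℝ) * (P x.1 * P x.2)))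
      (fun x => by have := hP0 x.1; have := hP0 x.2; positivity) (2 * n))
    rw [← Finset.mul_sum]
    refine (mul_le_mul_of_nonneg_left (hgain a) (Nat.cast_nonneg _)).trans (le_of_eq ?_)
    rw [Finset.mul_sum, Finset.mul_sum]
    refine Finset.sum_congr rfl fun ij hij => ?_
    rw [Finset.HasAntidiagonal.mem_antidiagonal.1 hij]; ring
  have hA : ∑ i ∈ Finset.range (2 * n), P i ≤ armSum c := by
    simp only [hP]
    rw [← Finset.sum_product']
    exact sum_le_hasSum _ (fun p _ => armFlux_nonneg hc p.1 p.2) (hasSum_armFlux hs)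
  have hL : ∑ i ∈ Finset.range (2 * n), ∑ j ∈ Finset.range (2 * n),
      1 / 2 * (((tent n (i + 1) : ℝ) + tent n (j + 1)) * (P i * P j)) ≤
      ∑ a ∈ Finset.range (2 * n), ∑ m ∈ Finset.range n, (tent n a : ℝ) * coagLoss c a m := by
    have e1 : ∑ a ∈ Finset.range (2 * n), ∑ m ∈ Finset.range n, (tent n a : ℝ) * coagLoss c a m =
        (∑ i ∈ Finset.range (2 * n), (tent n (i + 1) : ℝ) * P i) * armSum c := by
      have e2 : ∀ a, ∑ m ∈ Finset.range n, (tent n a : ℝ) * coagLoss c a m =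
          (tent n a : ℝ) * (a * ∑ m ∈ Finset.range n, c a m) * armSum c := fun a => by
        rw [Finset.mul_sum, Finset.mul_sum, Finset.sum_mul]
        exact Finset.sum_congr rfl fun m _ => by rw [coagLoss_eq]; ring
      have e3 : ∀ i : ℕ, (((i + 1 : ℕ) : ℝ) * ∑ m ∈ Finset.range n, c (i + 1) m) = P i :=
        fun i => by
          rw [hP, Finset.mul_sum]
          simp [armFlux]
      simp only [e2]
      rw [← Finset.sum_mul]
      congr 1
      have e4 := Finset.sum_range_succ (fun a => (tent n a : ℝ) *
        (a * ∑ m ∈ Finset.range n, c a m)) (2 * n)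
      rw [Finset.sum_range_succ'] at e4
      simp only [e3] at e4
      simpa [tent] using e4.symm
    rw [e1]
    refine le_trans (le_of_eq ?_) (mul_le_mul_of_nonneg_left hA
      (Finset.sum_nonneg fun i _ => mul_nonneg (Nat.cast_nonneg _) (hP0 i)))
    have s1 : (∑ i ∈ Finset.range (2 * n), (tent n (i + 1) : ℝ) * P i) *
        ∑ i ∈ Finset.range (2 * n), P i = ∑ i ∈ Finset.range (2 * n),
          ∑ j ∈ Finset.range (2 * n), (tent n (i + 1) : ℝ) * P i * P j := Finset.sum_mul_sum ..
    have s2 : (∑ i ∈ Finset.range (2 * n), (tent n (i + 1) : ℝ) * P i) *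
        ∑ i ∈ Finset.range (2 * n), P i = ∑ i ∈ Finset.range (2 * n),
          ∑ j ∈ Finset.range (2 * n), (tent n (j + 1) : ℝ) * P j * P i := by
      rw [s1, Finset.sum_comm]
    have s3 : ∑ i ∈ Finset.range (2 * n), ∑ j ∈ Finset.range (2 * n),
        1 / 2 * (((tent n (i + 1) : ℝ) + tent n (j + 1)) * (P i * P j)) =
        1 / 2 * ∑ i ∈ Finset.range (2 * n), ∑ j ∈ Finset.range (2 * n),
          (tent n (i + 1) : ℝ) * P i * P j + 1 / 2 * ∑ i ∈ Finset.range (2 * n),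
          ∑ j ∈ Finset.range (2 * n), (tent n (j + 1) : ℝ) * P j * P i := by
      simp only [Finset.mul_sum, ← Finset.sum_add_distrib]
      exact Finset.sum_congr rfl fun i _ => Finset.sum_congr rfl fun j _ => by ring
    rw [s3, ← s1, ← s2]; ring
  have hS : armPartial c n ^ 2 ≤ ∑ i ∈ Finset.range (2 * n), ∑ j ∈ Finset.range (2 * n),
      1 / 2 * ((if i < n ∧ j < n then 2 else 0 : ℝ) * (P i * P j)) := by
    have e : armPartial c n ^ 2 =
        ∑ i ∈ Finset.range n, ∑ j ∈ Finset.range n, P i * P j := by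
      rw [sq, armPartial, Finset.sum_mul_sum]
    have hn : Finset.range n ⊆ Finset.range (2 * n) := Finset.range_mono (by omega)
    have hnn : ∀ i j, (0 : ℝ) ≤ 1 / 2 * ((if i < n ∧ j < n then 2 else 0 : ℝ) * (P i * P j)) :=
      fun i j => by
        have := hP0 i; have := hP0 j
        split_ifs <;> positivity
    rw [e]
    refine (Finset.sum_le_sum fun i hi => ?_).trans (Finset.sum_le_sum_of_subset_of_nonneg hn
      fun i _ _ => Finset.sum_nonneg fun j _ => hnn i j)
    refine (Finset.sum_le_sum fun j hj => ?_).trans (Finset.sum_le_sum_of_subset_of_nonneg hn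
      fun j _ _ => hnn i j)
    rw [if_pos ⟨Finset.mem_range.1 hi, Finset.mem_range.1 hj⟩]
    linarith
  have hB : ∑ i ∈ Finset.range (2 * n), ∑ j ∈ Finset.range (2 * n),
        1 / 2 * ((tent n (i + j) : ℝ) * (P i * P j)) +
      ∑ i ∈ Finset.range (2 * n), ∑ j ∈ Finset.range (2 * n),
        1 / 2 * ((if i < n ∧ j < n then 2 else 0 : ℝ) * (P i * P j)) ≤
      ∑ i ∈ Finset.range (2 * n), ∑ j ∈ Finset.range (2 * n),
        1 / 2 * (((tent n (i + 1) : ℝ) + tent n (j + 1)) * (P i * P j)) := by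
    simp only [← Finset.sum_add_distrib]
    refine Finset.sum_le_sum fun i hi => Finset.sum_le_sum fun j hj => ?_
    have := mul_le_mul_of_nonneg_right (tent_bracket n i j (Finset.mem_range.1 hi)
      (Finset.mem_range.1 hj)) (mul_nonneg (hP0 i) (hP0 j))
    linarith
  simp only [mul_sub, Finset.sum_sub_distrib]
  linarith

end Flux

section Solution

variable {c : ℝ → ℕ → ℕ → ℝ} {c₀ : ℕ → ℕ → ℝ}

namespace IsModifiedSmoluchowskiSolution

lemma nonneg (hc : IsModifiedSmoluchowskiSolution c c₀) {t : ℝ} (ht : 0 ≤ t) (a m : ℕ) :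
    0 ≤ c t a m := hc.1 t ht a m

lemma mass_zero (hc : IsModifiedSmoluchowskiSolution c c₀) {t : ℝ} (ht : 0 ≤ t) (a : ℕ) :
    c t a 0 = 0 := hc.2.1 t ht a

lemma continuousOn (hc : IsModifiedSmoluchowskiSolution c c₀) (a m : ℕ) :
    ContinuousOn (fun t => c t a m) (Ici 0) := hc.2.2.1 a m

lemma arm_nonneg (hc : IsModifiedSmoluchowskiSolution c c₀) {t : ℝ} (ht : 0 ≤ t) :
    0 ≤ armSum (c t) :=
  tsum_nonneg fun _ => mul_nonneg (Nat.cast_nonneg _) (hc.nonneg ht _ _)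

lemma exists_arm_bounds (hc : IsModifiedSmoluchowskiSolution c c₀) {T : ℝ} (hT : 0 ≤ T) :
    ∃ b B, 0 < b ∧ ∀ s ∈ Icc 0 T, b ≤ armSum (c s) ∧ armSum (c s) ≤ B := by
  obtain ⟨h1, ⟨B, hB⟩, -⟩ := hc.2.2.2 T hT
  refine ⟨_, B, h1, fun s hs => ⟨csInf_le ⟨0, ?_⟩ ⟨s, hs, rfl⟩, hB ⟨s, hs, rfl⟩⟩⟩
  rintro _ ⟨s, hs, rfl⟩
  exact hc.arm_nonneg hs.1

lemma arm_pos (hc : IsModifiedSmoluchowskiSolution c c₀) {t : ℝ} (ht : 0 ≤ t) :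
    0 < armSum (c t) := by
  obtain ⟨b, B, hb, h⟩ := hc.exists_arm_bounds ht
  exact hb.trans_le (h t ⟨ht, le_rfl⟩).1

lemma summable_arm (hc : IsModifiedSmoluchowskiSolution c c₀) {t : ℝ} (ht : 0 ≤ t) :
    Summable fun p : ℕ × ℕ => (p.1 : ℝ) * c t p.1 p.2 := by
  by_contra h
  exact (hc.arm_pos ht).ne' (tsum_eq_zero_of_not_summable h)

lemma initial_eq (hc : IsModifiedSmoluchowskiSolution c c₀) (h₀ : ∀ a, c₀ a 0 = 0) : c 0 = c₀ := by
  funext a m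
  rcases Nat.eq_zero_or_pos m with rfl | hm
  · rw [h₀, hc.mass_zero le_rfl]
  · have := (hc.2.2.2 0 self_mem_Ici).2.2.2 a m hm
    rw [intervalIntegral.integral_same] at this
    linarith

lemma aestronglyMeasurable_arm (hc : IsModifiedSmoluchowskiSolution c c₀) {T : ℝ} (hT : 0 ≤ T) :
    AEStronglyMeasurable (fun s => armSum (c s)) (volume.restrict (Ioc 0 T)) := by
  have h := (hc.2.2.2 T hT).2.2.1.1.aestronglyMeasurable.aemeasurable.sqrt
  refine (h.congr ?_).aestronglyMeasurable
  filter_upwards [ae_restrict_mem measurableSet_Ioc] with s hs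
  exact Real.sqrt_sq (hc.arm_nonneg hs.1.le)

lemma intervalIntegrable_arm (hc : IsModifiedSmoluchowskiSolution c c₀) {s t : ℝ} (hs : 0 ≤ s)
    (hst : s ≤ t) : IntervalIntegrable (fun s => armSum (c s)) volume s t := by
  obtain ⟨b, B, hb, h⟩ := hc.exists_arm_bounds (hs.trans hst)
  have hsub : Ioc s t ⊆ Ioc 0 t := Ioc_subset_Ioc_left hs
  rw [intervalIntegrable_iff_integrableOn_Ioc_of_le hst]
  refine Integrable.of_bound ((hc.aestronglyMeasurable_arm (hs.trans hst)).mono_set hsub) B ?_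
  filter_upwards [ae_restrict_mem measurableSet_Ioc] with r hr
  have hr' : r ∈ Icc 0 t := ⟨hs.trans hr.1.le, hr.2⟩
  rw [Real.norm_of_nonneg (hc.arm_nonneg hr'.1)]
  exact (h r hr').2

lemma intervalIntegrable_inv_arm (hc : IsModifiedSmoluchowskiSolution c c₀) {s t : ℝ} (hs : 0 ≤ s)
    (hst : s ≤ t) : IntervalIntegrable (fun s => (armSum (c s))⁻¹) volume s t := by
  obtain ⟨b, B, hb, h⟩ := hc.exists_arm_bounds (hs.trans hst)
  have hsub : Ioc s t ⊆ Ioc 0 t := Ioc_subset_Ioc_left hs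
  rw [intervalIntegrable_iff_integrableOn_Ioc_of_le hst]
  refine Integrable.of_bound
    ((hc.aestronglyMeasurable_arm (hs.trans hst)).aemeasurable.inv.aestronglyMeasurable.mono_set
      hsub) b⁻¹ ?_
  filter_upwards [ae_restrict_mem measurableSet_Ioc] with r hr
  have hr' : r ∈ Icc 0 t := ⟨hs.trans hr.1.le, hr.2⟩
  rw [Real.norm_of_nonneg (inv_nonneg.2 (hc.arm_nonneg hr'.1))]
  exact inv_anti₀ hb (h r hr').1

lemma continuousOn_coagGain (hc : IsModifiedSmoluchowskiSolution c c₀) (a m : ℕ) :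
    ContinuousOn (fun s => coagGain (c s) a m) (Ici 0) := by
  refine continuousOn_const.mul (continuousOn_finsetSum _ fun a' _ =>
    continuousOn_finsetSum _ fun m' _ => ?_)
  exact (continuousOn_const.mul (hc.continuousOn _ _)).mul (hc.continuousOn _ _)

lemma Icc_subset_Ici {s t : ℝ} (hs : 0 ≤ s) (hst : s ≤ t) : uIcc s t ⊆ Ici 0 := by
  rw [uIcc_of_le hst]; exact fun r hr => hs.trans hr.1

lemma inv_arm_mul_sub (hc : IsModifiedSmoluchowskiSolution c c₀) {s : ℝ} (hs : 0 ≤ s) (a m : ℕ) :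
    (armSum (c s))⁻¹ * (coagGain (c s) a m - coagLoss (c s) a m) =
      (armSum (c s))⁻¹ * coagGain (c s) a m - a * c s a m := by
  have := (hc.arm_pos hs).ne'
  rw [coagLoss_eq]; field_simp

lemma intervalIntegrable_gain (hc : IsModifiedSmoluchowskiSolution c c₀) {s t : ℝ} (hs : 0 ≤ s)
    (hst : s ≤ t) (a m : ℕ) :
    IntervalIntegrable (fun r => (armSum (c r))⁻¹ * coagGain (c r) a m) volume s t :=
  (hc.intervalIntegrable_inv_arm hs hst).mul_continuousOn
    ((hc.continuousOn_coagGain a m).mono (Icc_subset_Ici hs hst))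

lemma intervalIntegrable_rate (hc : IsModifiedSmoluchowskiSolution c c₀) {s t : ℝ} (hs : 0 ≤ s)
    (hst : s ≤ t) (a m : ℕ) : IntervalIntegrable
      (fun r => (armSum (c r))⁻¹ * (coagGain (c r) a m - coagLoss (c r) a m)) volume s t := by
  have h := (hc.intervalIntegrable_gain hs hst a m).sub
    (((hc.continuousOn a m).mono (Icc_subset_Ici hs hst)).const_smul (a : ℝ)).intervalIntegrable
  refine h.congr fun r hr => ?_
  rw [uIoc_of_le hst] at hr
  exact (hc.inv_arm_mul_sub (hs.trans hr.1.le) a m).symm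

lemma sub_eq_integral (hc : IsModifiedSmoluchowskiSolution c c₀) {s t : ℝ} (hs : 0 ≤ s)
    (hst : s ≤ t) (a m : ℕ) : c t a m - c s a m =
      ∫ r in s..t, (armSum (c r))⁻¹ * (coagGain (c r) a m - coagLoss (c r) a m) := by
  rcases Nat.eq_zero_or_pos m with rfl | hm
  · rw [hc.mass_zero hs, hc.mass_zero (hs.trans hst), sub_zero,
      intervalIntegral.integral_congr (g := fun _ => 0) fun r hr => ?_]
    · simp
    · have hr0 := Icc_subset_Ici hs hst hr
      simp [hc.mass_zero hr0, coagGain, coagLoss_eq]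
  · have h1 := (hc.2.2.2 s hs).2.2.2 a m hm
    have h2 := (hc.2.2.2 t (hs.trans hst)).2.2.2 a m hm
    rw [← intervalIntegral.integral_interval_sub_left
      (hc.intervalIntegrable_rate le_rfl (hs.trans hst) a m)
      (hc.intervalIntegrable_rate le_rfl hs a m), ← h1, ← h2]
    ring

lemma continuousOn_armPartial (hc : IsModifiedSmoluchowskiSolution c c₀) (n : ℕ) :
    ContinuousOn (fun s => armPartial (c s) n) (Ici 0) :=
  continuousOn_finsetSum _ fun _ _ => continuousOn_finsetSum _ fun _ _ =>
    continuousOn_const.mul (hc.continuousOn _ _)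

lemma armPartial_le_sub (hc : IsModifiedSmoluchowskiSolution c c₀) {s t : ℝ} (hs : 0 ≤ s)
    (hst : s ≤ t) (n : ℕ) : armPartial (c t) n ≤
      armSum (c s) - ∫ r in s..t, (armSum (c r))⁻¹ * armPartial (c r) n ^ 2 := by
  have ht := hs.trans hst
  set Φ : ℝ → ℝ := fun r => ∑ a ∈ Finset.range (2 * n), ∑ m ∈ Finset.range n,
    (tent n a : ℝ) * c r a m with hΦ
  have hle : ∀ {r}, 0 ≤ r → Φ r ≤ armSum (c r) := fun {r} hr => by
    rw [hΦ]
    simp only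
    rw [← Finset.sum_product']
    refine (Finset.sum_le_sum fun p _ => mul_le_mul_of_nonneg_right (Nat.cast_le.2 ?_)
      (hc.nonneg hr p.1 p.2)).trans (sum_le_hasSum _
        (fun p _ => mul_nonneg (Nat.cast_nonneg _) (hc.nonneg hr p.1 p.2))
        (hc.summable_arm hr).hasSum)
    exact min_le_left _ _
  have hge : armPartial (c t) n ≤ Φ t := by
    have hn : Finset.Ico 1 (n + 1) ⊆ Finset.range (2 * n) := fun a ha => by
      simp only [Finset.mem_Ico, Finset.mem_range] at *; omega
    refine le_trans (le_of_eq ?_) (Finset.sum_le_sum_of_subset_of_nonneg hn fun a _ _ =>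
      Finset.sum_nonneg fun m _ => mul_nonneg (Nat.cast_nonneg _) (hc.nonneg ht a m))
    rw [Finset.sum_Ico_eq_sum_range, armPartial]
    refine Finset.sum_congr rfl fun i hi => Finset.sum_congr rfl fun m _ => ?_
    have hi := Finset.mem_range.1 hi
    have h1 : tent n (1 + i) = i + 1 := by unfold tent; omega
    rw [armFlux, h1, add_comm 1 i]; push_cast; ring
  have hsub : Φ t - Φ s = ∫ r in s..t, (armSum (c r))⁻¹ *
      ∑ a ∈ Finset.range (2 * n), ∑ m ∈ Finset.range n,
        (tent n a : ℝ) * (coagGain (c r) a m - coagLoss (c r) a m) := by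
    have h1 : ∀ r, (armSum (c r))⁻¹ * ∑ a ∈ Finset.range (2 * n), ∑ m ∈ Finset.range n,
        (tent n a : ℝ) * (coagGain (c r) a m - coagLoss (c r) a m) =
        ∑ a ∈ Finset.range (2 * n), ∑ m ∈ Finset.range n, (tent n a : ℝ) *
          ((armSum (c r))⁻¹ * (coagGain (c r) a m - coagLoss (c r) a m)) := fun r => by
      simp only [Finset.mul_sum]
      exact Finset.sum_congr rfl fun a _ => Finset.sum_congr rfl fun m _ => by ring
    simp only [h1]
    have hint : ∀ a m, IntervalIntegrable (fun r => (tent n a : ℝ) *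
        ((armSum (c r))⁻¹ * (coagGain (c r) a m - coagLoss (c r) a m))) volume s t :=
      fun a m => (hc.intervalIntegrable_rate hs hst a m).const_mul _
    rw [intervalIntegral.integral_finsetSum fun a _ => (IntervalIntegrable.sum
      (Finset.range n) fun m _ => hint a m).congr fun r _ => by simp]
    rw [hΦ, ← Finset.sum_sub_distrib]
    refine Finset.sum_congr rfl fun a _ => ?_
    rw [intervalIntegral.integral_finsetSum fun m _ => hint a m, ← Finset.sum_sub_distrib]
    refine Finset.sum_congr rfl fun m _ => ?_
    rw [intervalIntegral.integral_const_mul, ← hc.sub_eq_integral hs hst]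
    ring
  have hmono : (∫ r in s..t, (armSum (c r))⁻¹ *
      ∑ a ∈ Finset.range (2 * n), ∑ m ∈ Finset.range n,
        (tent n a : ℝ) * (coagGain (c r) a m - coagLoss (c r) a m)) ≤
      ∫ r in s..t, -((armSum (c r))⁻¹ * armPartial (c r) n ^ 2) := by
    refine intervalIntegral.integral_mono_on hst ?_ ?_ fun r hr => ?_
    · have h1 : IntervalIntegrable (fun r => ∑ a ∈ Finset.range (2 * n), ∑ m ∈ Finset.range n,
          (tent n a : ℝ) * ((armSum (c r))⁻¹ * (coagGain (c r) a m - coagLoss (c r) a m)))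
          volume s t := by
        have := IntervalIntegrable.sum (Finset.range (2 * n)) fun a _ =>
          IntervalIntegrable.sum (Finset.range n) fun m _ =>
            (hc.intervalIntegrable_rate hs hst a m).const_mul (tent n a : ℝ)
        refine this.congr fun r _ => ?_
        simp
      refine h1.congr fun r _ => ?_
      simp only [Finset.mul_sum]
      exact Finset.sum_congr rfl fun a _ => Finset.sum_congr rfl fun m _ => by ring
    · exact ((hc.intervalIntegrable_inv_arm hs hst).mul_continuousOn
        (((hc.continuousOn_armPartial n).pow 2).mono (Icc_subset_Ici hs hst))).neg
    · have hr0 := hs.trans hr.1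
      have := mul_le_mul_of_nonneg_left (sum_tent_mul_gain_le (fun a m => hc.nonneg hr0 a m)
        (fun a => hc.mass_zero hr0 a) (hc.summable_arm hr0) n) (inv_nonneg.2 (hc.arm_nonneg hr0))
      linarith
  rw [intervalIntegral.integral_neg] at hmono
  linarith [hle hs]

/-- The number of arms decreases at least as fast as its own integral. -/
lemma arm_le_sub_integral (hc : IsModifiedSmoluchowskiSolution c c₀) {s t : ℝ} (hs : 0 ≤ s)
    (hst : s ≤ t) : armSum (c t) ≤ armSum (c s) - ∫ r in s..t, armSum (c r) := by
  refine le_of_tendsto_of_tendsto' (tendsto_armPartial (hc.summable_arm (hs.trans hst)))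
    (tendsto_const_nhds.sub ?_) (hc.armPartial_le_sub hs hst)
  have hr0 : ∀ {r}, r ∈ uIoc s t → 0 ≤ r := fun hr =>
    mem_Ici.1 (Icc_subset_Ici hs hst (uIoc_subset_uIcc hr))
  refine intervalIntegral.tendsto_integral_filter_of_dominated_convergence
    (fun r => armSum (c r)) (Eventually.of_forall fun n => ?_)
    (Eventually.of_forall fun n => ae_of_all _ fun r hr => ?_)
    (hc.intervalIntegrable_arm hs hst) (ae_of_all _ fun r hr => ?_)
  · exact ((hc.intervalIntegrable_inv_arm hs hst).mul_continuousOn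
      (((hc.continuousOn_armPartial n).pow 2).mono
        (Icc_subset_Ici hs hst))).def'.aestronglyMeasurable
  · have hA := hc.arm_pos (hr0 hr)
    have h0 := armPartial_nonneg (fun a m => hc.nonneg (hr0 hr) a m) n
    have h1 := armPartial_le (fun a m => hc.nonneg (hr0 hr) a m) (hc.summable_arm (hr0 hr)) n
    rw [Real.norm_of_nonneg (by positivity), inv_mul_le_iff₀ hA, ← sq]
    exact pow_le_pow_left₀ h0 h1 2
  · have hA := (hc.arm_pos (hr0 hr)).ne'
    have := ((tendsto_armPartial (hc.summable_arm (hr0 hr))).pow 2).const_mul (armSum (c r))⁻¹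
    rwa [sq, inv_mul_cancel_left₀ hA] at this

lemma arm_anti (hc : IsModifiedSmoluchowskiSolution c c₀) {s t : ℝ} (hs : 0 ≤ s)
    (hst : s ≤ t) : armSum (c t) ≤ armSum (c s) := by
  have := hc.arm_le_sub_integral hs hst
  have h2 : 0 ≤ ∫ r in s..t, armSum (c r) :=
    intervalIntegral.integral_nonneg hst fun r hr => hc.arm_nonneg (hs.trans hr.1)
  linarith

lemma one_add_mul_arm_le (hc : IsModifiedSmoluchowskiSolution c c₀) {s t : ℝ} (hs : 0 ≤ s)
    (hst : s ≤ t) : (1 + (t - s)) * armSum (c t) ≤ armSum (c s) := by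
  have := hc.arm_le_sub_integral hs hst
  have h2 : ∫ _ in s..t, armSum (c t) ≤ ∫ r in s..t, armSum (c r) :=
    intervalIntegral.integral_mono_on hst (by simp) (hc.intervalIntegrable_arm hs hst)
      fun r hr => hc.arm_anti (hs.trans hr.1) hr.2
  rw [intervalIntegral.integral_const, smul_eq_mul] at h2
  linarith

lemma exp_mul_arm_le (hc : IsModifiedSmoluchowskiSolution c c₀) {s t : ℝ} (hs : 0 ≤ s)
    (hst : s ≤ t) : Real.exp t * armSum (c t) ≤ Real.exp s * armSum (c s) := by
  have key : ∀ (h : ℝ), 0 ≤ h → ∀ k : ℕ,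
      (1 + h) ^ k * armSum (c (s + k * h)) ≤ armSum (c s) := by
    intro h hh k
    induction k with
    | zero => simp
    | succ k ih =>
      have hk : 0 ≤ s + k * h := by positivity
      have h1 := hc.one_add_mul_arm_le hk (t := s + (k + 1 : ℕ) * h) (by push_cast; linarith)
      have h2 : s + (k + 1 : ℕ) * h - (s + k * h) = h := by push_cast; ring
      rw [h2] at h1
      calc (1 + h) ^ (k + 1) * armSum (c (s + (k + 1 : ℕ) * h))
          = (1 + h) ^ k * ((1 + h) * armSum (c (s + (k + 1 : ℕ) * h))) := by ring
        _ ≤ (1 + h) ^ k * armSum (c (s + k * h)) := by gcongr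
        _ ≤ _ := ih
  have hlim := (Real.tendsto_one_add_div_pow_exp (t - s)).mul_const (armSum (c t))
  have hle : Real.exp (t - s) * armSum (c t) ≤ armSum (c s) := by
    refine le_of_tendsto hlim ((eventually_gt_atTop 0).mono fun n hn => ?_)
    have hn' : (n : ℝ) ≠ 0 := Nat.cast_ne_zero.2 hn.ne'
    have := key ((t - s) / n) (div_nonneg (sub_nonneg.2 hst) n.cast_nonneg) n
    rwa [mul_div_cancel₀ _ hn', add_sub_cancel] at this
  calc Real.exp t * armSum (c t) = Real.exp s * (Real.exp (t - s) * armSum (c t)) := by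
        rw [← mul_assoc, ← Real.exp_add]; congr 2; ring
    _ ≤ _ := by gcongr

end IsModifiedSmoluchowskiSolution
end Solution

section Clock

variable {β : ℝ → ℝ} {b T : ℝ}

lemma intervalIntegrable_of_mem_Icc (hβ : IntervalIntegrable β volume 0 T) {s t : ℝ}
    (hs : s ∈ Icc 0 T) (ht : t ∈ Icc 0 T) : IntervalIntegrable β volume s t :=
  hβ.mono_set (uIcc_subset_uIcc (by rwa [uIcc_of_le (hs.1.trans hs.2)])
    (by rwa [uIcc_of_le (hs.1.trans hs.2)]))

lemma clock_sub (hβ : IntervalIntegrable β volume 0 T) {s t : ℝ}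
    (hs : s ∈ Icc 0 T) (ht : t ∈ Icc 0 T) :
    (∫ r in (0:ℝ)..t, β r) - ∫ r in (0:ℝ)..s, β r = ∫ r in s..t, β r := by
  have h0 : (0 : ℝ) ∈ Icc 0 T := ⟨le_rfl, hs.1.trans hs.2⟩
  exact integral_interval_sub_left (intervalIntegrable_of_mem_Icc hβ h0 ht)
    (intervalIntegrable_of_mem_Icc hβ h0 hs)

lemma mul_sub_le_clock_sub (hβ : IntervalIntegrable β volume 0 T)
    (hbβ : ∀ s ∈ Icc 0 T, b ≤ β s) {s t : ℝ} (hs : s ∈ Icc 0 T) (ht : t ∈ Icc 0 T)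
    (hst : s ≤ t) : b * (t - s) ≤ (∫ r in (0:ℝ)..t, β r) - ∫ r in (0:ℝ)..s, β r := by
  rw [clock_sub hβ hs ht]
  have := intervalIntegral.integral_mono_on (f := fun _ => b) (μ := volume) hst (by simp)
    (intervalIntegrable_of_mem_Icc hβ hs ht) fun r hr => hbβ r ⟨hs.1.trans hr.1, hr.2.trans ht.2⟩
  simpa [mul_comm] using this

lemma abs_sub_le_clock (hβ : IntervalIntegrable β volume 0 T) (hb : 0 < b)
    (hbβ : ∀ s ∈ Icc 0 T, b ≤ β s) {s t : ℝ} (hs : s ∈ Icc 0 T) (ht : t ∈ Icc 0 T) :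
    |t - s| ≤ b⁻¹ * |(∫ r in (0:ℝ)..t, β r) - ∫ r in (0:ℝ)..s, β r| := by
  rw [inv_mul_eq_div, le_div_iff₀ hb, mul_comm]
  rcases le_total s t with h | h
  · have := mul_sub_le_clock_sub hβ hbβ hs ht h
    rw [abs_of_nonneg (sub_nonneg.2 h)]
    exact this.trans (le_abs_self _)
  · have := mul_sub_le_clock_sub hβ hbβ ht hs h
    rw [abs_sub_comm, abs_of_nonneg (sub_nonneg.2 h), abs_sub_comm]
    exact this.trans (le_abs_self _)

lemma exists_clock_inverse (hT : 0 ≤ T) (hβ : IntervalIntegrable β volume 0 T) (hb : 0 < b)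
    (hbβ : ∀ s ∈ Icc 0 T, b ≤ β s) :
    ∃ θ : ℝ → ℝ, (∀ τ ∈ Icc 0 (∫ r in (0:ℝ)..T, β r), θ τ ∈ Icc 0 T ∧
      ∫ r in (0:ℝ)..(θ τ), β r = τ) ∧ ContinuousOn θ (Icc 0 (∫ r in (0:ℝ)..T, β r)) ∧
      θ 0 = 0 ∧ θ (∫ r in (0:ℝ)..T, β r) = T := by
  have h0 : (0 : ℝ) ∈ Icc 0 T := ⟨le_rfl, hT⟩
  have hTm : T ∈ Icc 0 T := ⟨hT, le_rfl⟩
  have hcont : ContinuousOn (fun t => ∫ r in (0:ℝ)..t, β r) (Icc 0 T) := by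
    have := continuousOn_primitive_interval' hβ left_mem_uIcc
    rwa [uIcc_of_le hT] at this
  have hsurj := intermediate_value_Icc hT hcont
  simp only [integral_same] at hsurj
  have hex : ∀ τ, ∃ s, τ ∈ Icc 0 (∫ r in (0:ℝ)..T, β r) →
      s ∈ Icc 0 T ∧ ∫ r in (0:ℝ)..s, β r = τ := fun τ => by
    by_cases hτ : τ ∈ Icc 0 (∫ r in (0:ℝ)..T, β r)
    · obtain ⟨s, hs⟩ := hsurj hτ
      exact ⟨s, fun _ => hs⟩
    · exact ⟨0, fun h => absurd h hτ⟩
  choose θ hθ using hex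
  have hinj : ∀ s ∈ Icc 0 T, ∀ t ∈ Icc 0 T, (∫ r in (0:ℝ)..s, β r) = ∫ r in (0:ℝ)..t, β r →
      s = t := fun s hs t ht h => by
    have := abs_sub_le_clock hβ hb hbβ ht hs
    rw [h, sub_self, abs_zero, mul_zero] at this
    exact sub_eq_zero.1 (abs_nonpos_iff.1 this)
  have hpos : 0 ≤ ∫ r in (0:ℝ)..T, β r :=
    integral_nonneg hT fun s hs => hb.le.trans (hbβ s hs)
  refine ⟨θ, hθ, ?_, ?_, ?_⟩
  · refine (LipschitzOnWith.of_dist_le_mul (K := b⁻¹.toNNReal) fun τ hτ σ hσ => ?_).continuousOn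
    have := abs_sub_le_clock hβ hb hbβ (hθ σ hσ).1 (hθ τ hτ).1
    rwa [(hθ σ hσ).2, (hθ τ hτ).2, ← Real.dist_eq, ← Real.dist_eq,
      ← Real.coe_toNNReal b⁻¹ (inv_nonneg.2 hb.le)] at this
  · obtain ⟨h1, h2⟩ := hθ 0 ⟨le_rfl, hpos⟩
    exact hinj _ h1 _ h0 (by rw [h2, integral_same])
  · obtain ⟨h1, h2⟩ := hθ _ ⟨hpos, le_rfl⟩
    exact hinj _ h1 _ hTm h2

/-- Differentiation with respect to the clock `∫ β`. -/
lemma hasDerivAt_comp_clock_inverse (hβ : IntervalIntegrable β volume 0 T)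
    (hβ0 : ∀ s ∈ Icc 0 T, 0 ≤ β s) {f Q θ : ℝ → ℝ}
    (hf : ∀ t ∈ Icc 0 T, f t = f 0 + ∫ r in (0:ℝ)..t, β r * Q r) (hQ : ContinuousOn Q (Icc 0 T))
    (hθ : ∀ τ ∈ Icc 0 (∫ r in (0:ℝ)..T, β r), θ τ ∈ Icc 0 T ∧ ∫ r in (0:ℝ)..(θ τ), β r = τ)
    (hθc : ContinuousOn θ (Icc 0 (∫ r in (0:ℝ)..T, β r))) {τ : ℝ}
    (hτ : τ ∈ Ioo 0 (∫ r in (0:ℝ)..T, β r)) :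
    HasDerivAt (fun τ => f (θ τ)) (Q (θ τ)) τ := by
  have hτ' := Ioo_subset_Icc_self hτ
  have hnhds : Icc 0 (∫ r in (0:ℝ)..T, β r) ∈ 𝓝 τ := Icc_mem_nhds hτ.1 hτ.2
  have hmem := (hθ τ hτ').1
  have hint : ∀ {s t}, s ∈ Icc 0 T → t ∈ Icc 0 T → IntervalIntegrable (fun r => β r * Q r)
      volume s t := fun hs ht => (intervalIntegrable_of_mem_Icc hβ hs ht).mul_continuousOn
        (hQ.mono (ordConnected_Icc.uIcc_subset hs ht))
  rw [hasDerivAt_iff_isLittleO, Asymptotics.isLittleO_iff]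
  intro ε hε
  obtain ⟨δ, hδ, hδQ⟩ := Metric.continuousOn_iff.1 hQ _ hmem ε hε
  have hnear : ∀ᶠ σ in 𝓝 τ, dist (θ σ) (θ τ) < δ :=
    Metric.tendsto_nhds.1 (hθc.continuousAt hnhds) δ hδ
  filter_upwards [hnear, hnhds] with σ hσ hσ'
  have hσm := (hθ σ hσ').1
  have h0 : (0 : ℝ) ∈ Icc 0 T := ⟨le_rfl, hmem.1.trans hmem.2⟩
  have e1 : f (θ σ) - f (θ τ) = ∫ r in (θ τ)..(θ σ), β r * Q r := by
    rw [hf _ hσm, hf _ hmem, add_sub_add_left_eq_sub,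
      integral_interval_sub_left (hint h0 hσm) (hint h0 hmem)]
  have e2 : σ - τ = ∫ r in (θ τ)..(θ σ), β r := by
    rw [← clock_sub hβ hmem hσm, (hθ σ hσ').2, (hθ τ hτ').2]
  have hsub : uIcc (θ τ) (θ σ) ⊆ Icc 0 T := ordConnected_Icc.uIcc_subset hmem hσm
  have e3 : f (θ σ) - f (θ τ) - (σ - τ) • Q (θ τ) =
      ∫ r in (θ τ)..(θ σ), β r * (Q r - Q (θ τ)) := by
    rw [e1, e2, smul_eq_mul, ← intervalIntegral.integral_mul_const, ← integral_sub (hint hmem hσm)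
      ((intervalIntegrable_of_mem_Icc hβ hmem hσm).mul_const _)]
    exact integral_congr fun r _ => by ring
  rw [e3, e2]
  have h3 : ‖∫ r in (θ τ)..(θ σ), β r * (Q r - Q (θ τ))‖ ≤
      |∫ r in (θ τ)..(θ σ), ε * β r| := by
    refine norm_integral_le_abs_of_norm_le ?_
      ((intervalIntegrable_of_mem_Icc hβ hmem hσm).const_mul ε)
    filter_upwards [ae_restrict_mem measurableSet_uIoc] with r hr
    have hr' := uIoc_subset_uIcc hr
    have hrm := hsub hr'
    have h1 : dist r (θ τ) < δ := by
      rw [Real.dist_eq] at hσ ⊢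
      refine lt_of_le_of_lt ?_ hσ
      rw [abs_sub_comm (θ σ)]
      exact (abs_sub_left_of_mem_uIcc hr').trans (le_of_eq (abs_sub_comm _ _))
    have h2 := hδQ r hrm h1
    rw [Real.dist_eq] at h2
    rw [norm_mul, Real.norm_of_nonneg (hβ0 r hrm), Real.norm_eq_abs, mul_comm]
    exact mul_le_mul_of_nonneg_right h2.le (hβ0 r hrm)
  rw [intervalIntegral.integral_const_mul, abs_mul, abs_of_pos hε] at h3
  exact h3

end Clock

section Duhamel

variable {c : ℝ → ℕ → ℕ → ℝ} {c₀ : ℕ → ℕ → ℝ}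

/-- Concentrations with the aggregation losses compensated. -/
noncomputable def lossless (c : ℝ → ℕ → ℕ → ℝ) (t : ℝ) (a m : ℕ) : ℝ :=
  Real.exp t ^ a * c t a m

/-- The rate of the intrinsic clock. -/
noncomputable def clockRate (c : ℝ → ℕ → ℕ → ℝ) (t : ℝ) : ℝ :=
  (Real.exp t ^ 2 * armSum (c t))⁻¹

namespace IsModifiedSmoluchowskiSolution

lemma clockRate_mul_coagGain (c : ℝ → ℕ → ℕ → ℝ) (t : ℝ) (a m : ℕ) :
    clockRate c t * coagGain (lossless c t) a m =
      Real.exp t ^ a * ((armSum (c t))⁻¹ * coagGain (c t) a m) := by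
  have h : coagGain (lossless c t) a m = _ := coagGain_pow_mul (c t) (Real.exp t) a m
  have := (Real.exp_pos t).ne'
  rw [h, clockRate, mul_inv, pow_add]
  field_simp

lemma lossless_eq_integral (hc : IsModifiedSmoluchowskiSolution c c₀)
    {t : ℝ} (ht : 0 ≤ t) (a m : ℕ) : lossless c t a m = lossless c 0 a m +
      ∫ r in (0:ℝ)..t, clockRate c r * coagGain (lossless c r) a m := by
  set rate : ℝ → ℝ := fun r => (armSum (c r))⁻¹ * (coagGain (c r) a m - coagLoss (c r) a m)
  have hrate : IntervalIntegrable rate volume 0 t := hc.intervalIntegrable_rate le_rfl ht a m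
  have hy : ∀ s ∈ Icc 0 t, c s a m = c 0 a m + ∫ r in (0:ℝ)..s, rate r := fun s hs => by
    rw [← hc.sub_eq_integral le_rfl hs.1]; ring
  have hf : AbsolutelyContinuousOnInterval (fun r : ℝ => Real.exp (a * r)) 0 t := by
    refine ContDiffOn.absolutelyContinuousOnInterval ?_
    fun_prop
  have hg : AbsolutelyContinuousOnInterval (fun s => c 0 a m + ∫ r in (0:ℝ)..s, rate r) 0 t :=
    (ContDiffOn.absolutelyContinuousOnInterval contDiffOn_const).fun_add
      (hrate.absolutelyContinuousOnInterval_intervalIntegral left_mem_uIcc)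
  have hparts := hf.integral_deriv_mul_eq_sub hg
  have hcongr : (∫ x in (0:ℝ)..t, deriv (fun r : ℝ => Real.exp (a * r)) x *
      (c 0 a m + ∫ r in (0:ℝ)..x, rate r) + Real.exp (a * x) *
      deriv (fun s => c 0 a m + ∫ r in (0:ℝ)..s, rate r) x) =
      ∫ r in (0:ℝ)..t, clockRate c r * coagGain (lossless c r) a m := by
    refine integral_congr_ae ?_
    filter_upwards [hrate.ae_hasDerivAt_integral] with x hx hxm
    have hxm' := uIoc_subset_uIcc hxm
    have h1 := ((hx hxm' 0 left_mem_uIcc).const_add (c 0 a m)).deriv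
    have h2 : HasDerivAt (fun r : ℝ => Real.exp (a * r)) (Real.exp (a * x) * a) x := by
      simpa using ((hasDerivAt_id x).const_mul (a : ℝ)).exp
    rw [uIcc_of_le ht] at hxm'
    rw [h1, h2.deriv, ← hy x hxm', clockRate_mul_coagGain, Real.exp_nat_mul]
    simp only [rate, hc.inv_arm_mul_sub hxm'.1]
    ring
  rw [hcongr] at hparts
  rw [hparts, ← hy t ⟨ht, le_rfl⟩]
  simp [lossless, Real.exp_nat_mul]

end IsModifiedSmoluchowskiSolution

end Duhamel

section Line

variable {e P r : ℝ → ℕ → ℝ} {z w τ₁ q B : ℝ}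

lemma line_ge (hw : 0 ≤ w) {τ : ℝ} (hτ : τ ≤ τ₁) : z ≤ z + (τ₁ - τ) * w :=
  le_add_of_nonneg_right (mul_nonneg (sub_nonneg.2 hτ) hw)

/-- A self-transported power series is constant along its characteristic lines. -/
lemma powSum_line_self (hτ₁ : 0 ≤ τ₁) (hz : 0 < z) (hB : 0 ≤ B) (hq0 : 0 ≤ q) (hq1 : q < 1)
    (hP : ∀ τ ∈ Icc 0 τ₁, ∀ a, 0 ≤ P τ a) (hwP : w = powSum (P τ₁) z)
    (hPb : ∀ τ ∈ Icc 0 τ₁, ∀ a, P τ a * (z + (τ₁ - τ) * w) ^ a ≤ B * q ^ a)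
    (hPc : ∀ a, ContinuousOn (fun τ => P τ a) (Icc 0 τ₁))
    (hPd : ∀ τ ∈ Ioo 0 τ₁, ∀ a, HasDerivAt (fun τ => P τ a) (transportConv (P τ) (P τ) a) τ) :
    ∀ τ ∈ Icc 0 τ₁, powSum (P τ) (z + (τ₁ - τ) * w) = w := by
  have hI : ∀ {τ}, τ ∈ Ioo 0 τ₁ → τ ∈ Icc 0 τ₁ := fun h => Ioo_subset_Icc_self h
  have hw : 0 ≤ w := hwP ▸ powSum_nonneg (hP τ₁ ⟨hτ₁, le_rfl⟩) hz.le
  have hbound : Summable fun i : ℕ => ((i : ℝ) + 1) * (B * q ^ i / z) := by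
    have h := fun n => summable_pow_mul_geometric_of_norm_lt_one (r := q) n
      (by rwa [Real.norm_of_nonneg hq0])
    refine (((h 1).add (h 0)).mul_left (B / z)).congr fun a => ?_
    ring
  have hdom : ∀ τ ∈ Ioo 0 τ₁, ∀ i : ℕ,
      (((i : ℝ) + 1) * P τ (i + 1)) * (z + (τ₁ - τ) * w) ^ i ≤ (i + 1) * (B * q ^ i / z) :=
    fun τ hτ i => succ_mul_pow_le (hP τ (hI hτ)) (hPb τ (hI hτ)) hz (line_ge hw hτ.2.le) hB hq0
      hq1.le i
  have key := eq_zero_of_hasDerivAt_mul_self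
    (u := fun τ => powSum (P τ) (z + (τ₁ - τ) * w) - w)
    (V := fun τ => ∑' i : ℕ, (((i : ℝ) + 1) * P τ (i + 1)) * (z + (τ₁ - τ) * w) ^ i)
    (K := ∑' i : ℕ, ((i : ℝ) + 1) * (B * q ^ i / z)) hτ₁
    ((continuousOn_powSum_line hz hw hq0 hq1 hP hPb hPc).sub continuousOn_const) ?_ ?_ ?_
  · exact fun τ hτ => sub_eq_zero.1 (key τ hτ)
  · intro τ hτ
    have h1 := hasDerivAt_powSum_line hz hw hB hq0 hq1 (fun τ h => hP τ (hI h))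
      (fun τ h => hPb τ (hI h)) (fun τ h => hP τ (hI h)) (fun τ h => hPb τ (hI h))
      (fun τ h a => transportConv_nonneg (hP τ (hI h)) (hP τ (hI h)) a) (fun τ h a => le_rfl)
      hPd hτ
    have h2 := (hasSum_transportConv_mul_pow (hP τ (hI hτ)) (hPb τ (hI hτ)) (hP τ (hI hτ))
      (hPb τ (hI hτ)) hz (line_ge hw hτ.2.le) hB hq0 hq1).tsum_eq
    refine (h1.sub_const w).congr_deriv ?_
    rw [powSum, h2]; ring
  · intro τ hτ
    have hZ : 0 ≤ z + (τ₁ - τ) * w := hz.le.trans (line_ge hw hτ.2.le)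
    have h0 : ∀ i : ℕ, 0 ≤ (((i : ℝ) + 1) * P τ (i + 1)) * (z + (τ₁ - τ) * w) ^ i := fun i =>
      mul_nonneg (mul_nonneg (by positivity) (hP τ (hI hτ) _)) (pow_nonneg hZ i)
    rw [abs_of_nonneg (tsum_nonneg h0)]
    exact (Summable.of_nonneg_of_le h0 (hdom τ hτ) hbound).tsum_le_tsum (hdom τ hτ) hbound
  · simp [← hwP]

/-- A transported power series is monotone along the characteristic lines. -/
lemma powSum_line_le (hτ₁ : 0 ≤ τ₁) (hz : 0 < z) (hw : 0 ≤ w) (hB : 0 ≤ B) (hq0 : 0 ≤ q)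
    (hq1 : q < 1)
    (hP : ∀ τ ∈ Icc 0 τ₁, ∀ a, 0 ≤ P τ a)
    (hPb : ∀ τ ∈ Icc 0 τ₁, ∀ a, P τ a * (z + (τ₁ - τ) * w) ^ a ≤ B * q ^ a)
    (hPw : ∀ τ ∈ Icc 0 τ₁, powSum (P τ) (z + (τ₁ - τ) * w) = w)
    (he : ∀ τ ∈ Icc 0 τ₁, ∀ a, 0 ≤ e τ a)
    (heb : ∀ τ ∈ Icc 0 τ₁, ∀ a, e τ a * (z + (τ₁ - τ) * w) ^ a ≤ B * q ^ a)
    (hec : ∀ a, ContinuousOn (fun τ => e τ a) (Icc 0 τ₁))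
    (hr0 : ∀ τ ∈ Ioo 0 τ₁, ∀ a, 0 ≤ r τ a)
    (hr : ∀ τ ∈ Ioo 0 τ₁, ∀ a, r τ a ≤ transportConv (e τ) (P τ) a)
    (hed : ∀ τ ∈ Ioo 0 τ₁, ∀ a, HasDerivAt (fun τ => e τ a) (r τ a) τ) :
    powSum (e τ₁) z ≤ powSum (e 0) (z + τ₁ * w) := by
  have hI : ∀ {τ}, τ ∈ Ioo 0 τ₁ → τ ∈ Icc 0 τ₁ := fun h => Ioo_subset_Icc_self h
  have hanti : AntitoneOn (fun τ => powSum (e τ) (z + (τ₁ - τ) * w)) (Icc 0 τ₁) := by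
    refine antitoneOn_of_hasDerivWithinAt_nonpos (convex_Icc 0 τ₁)
      (continuousOn_powSum_line hz hw hq0 hq1 he heb hec)
      (f' := fun τ => powSum (r τ) (z + (τ₁ - τ) * w) -
        w * ∑' i : ℕ, (((i : ℝ) + 1) * e τ (i + 1)) * (z + (τ₁ - τ) * w) ^ i) ?_ ?_
    · rw [interior_Icc]
      intro τ hτ
      exact (hasDerivAt_powSum_line hz hw hB hq0 hq1 (fun τ h => he τ (hI h))
        (fun τ h => heb τ (hI h)) (fun τ h => hP τ (hI h)) (fun τ h => hPb τ (hI h))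
        hr0 hr hed hτ).hasDerivWithinAt
    · rw [interior_Icc]
      intro τ hτ
      have hZ : 0 ≤ z + (τ₁ - τ) * w := hz.le.trans (line_ge hw hτ.2.le)
      have h2 := hasSum_transportConv_mul_pow (he τ (hI hτ)) (heb τ (hI hτ)) (hP τ (hI hτ))
        (hPb τ (hI hτ)) hz (line_ge hw hτ.2.le) hB hq0 hq1
      have h3 : ∀ a, r τ a * (z + (τ₁ - τ) * w) ^ a ≤
          transportConv (e τ) (P τ) a * (z + (τ₁ - τ) * w) ^ a := fun a =>
        mul_le_mul_of_nonneg_right (hr τ hτ a) (pow_nonneg hZ a)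
      have h4 : powSum (r τ) (z + (τ₁ - τ) * w) ≤ _ :=
        (Summable.of_nonneg_of_le (fun a => mul_nonneg (hr0 τ hτ a) (pow_nonneg hZ a)) h3
          h2.summable).tsum_le_tsum h3 h2.summable
      rw [h2.tsum_eq, hPw τ (hI hτ)] at h4
      linarith
  have := hanti (left_mem_Icc.2 hτ₁) (right_mem_Icc.2 hτ₁) hτ₁
  simpa using this

lemma powSum_line_eq (hτ₁ : 0 ≤ τ₁) (hz : 0 < z) (hw : 0 ≤ w) (hB : 0 ≤ B) (hq0 : 0 ≤ q)
    (hq1 : q < 1)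
    (hP : ∀ τ ∈ Icc 0 τ₁, ∀ a, 0 ≤ P τ a)
    (hPb : ∀ τ ∈ Icc 0 τ₁, ∀ a, P τ a * (z + (τ₁ - τ) * w) ^ a ≤ B * q ^ a)
    (hPw : ∀ τ ∈ Icc 0 τ₁, powSum (P τ) (z + (τ₁ - τ) * w) = w)
    (he : ∀ τ ∈ Icc 0 τ₁, ∀ a, 0 ≤ e τ a)
    (heb : ∀ τ ∈ Icc 0 τ₁, ∀ a, e τ a * (z + (τ₁ - τ) * w) ^ a ≤ B * q ^ a)
    (hec : ∀ a, ContinuousOn (fun τ => e τ a) (Icc 0 τ₁))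
    (hed : ∀ τ ∈ Ioo 0 τ₁, ∀ a, HasDerivAt (fun τ => e τ a) (transportConv (e τ) (P τ) a) τ) :
    powSum (e τ₁) z = powSum (e 0) (z + τ₁ * w) := by
  have hI : ∀ {τ}, τ ∈ Ioo 0 τ₁ → τ ∈ Icc 0 τ₁ := fun h => Ioo_subset_Icc_self h
  have hmono : MonotoneOn (fun τ => powSum (e τ) (z + (τ₁ - τ) * w)) (Icc 0 τ₁) := by
    refine monotoneOn_of_hasDerivWithinAt_nonneg (convex_Icc 0 τ₁)
      (continuousOn_powSum_line hz hw hq0 hq1 he heb hec) (f' := fun _ => 0) ?_ fun _ _ => le_rfl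
    rw [interior_Icc]
    intro τ hτ
    have h1 := hasDerivAt_powSum_line hz hw hB hq0 hq1 (fun τ h => he τ (hI h))
      (fun τ h => heb τ (hI h)) (fun τ h => hP τ (hI h)) (fun τ h => hPb τ (hI h))
      (fun τ h a => transportConv_nonneg (he τ (hI h)) (hP τ (hI h)) a) (fun τ h a => le_rfl)
      hed hτ
    have h2 := (hasSum_transportConv_mul_pow (he τ (hI hτ)) (heb τ (hI hτ)) (hP τ (hI hτ))
      (hPb τ (hI hτ)) hz (line_ge hw hτ.2.le) hB hq0 hq1).tsum_eq
    refine (h1.congr_deriv ?_).hasDerivWithinAt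
    rw [powSum, h2, hPw τ (hI hτ)]; ring
  refine le_antisymm (powSum_line_le hτ₁ hz hw hB hq0 hq1 hP hPb hPw he heb hec
    (fun τ h a => transportConv_nonneg (he τ (hI h)) (hP τ (hI h)) a) (fun τ h a => le_rfl) hed) ?_
  have := hmono (left_mem_Icc.2 hτ₁) (right_mem_Icc.2 hτ₁) hτ₁
  simpa using this

end Line

section GainMoments

variable {c : ℕ → ℕ → ℝ}

lemma mul_coagGain_eq (hc : ∀ a, c a 0 = 0) (a m : ℕ) : (m : ℝ) * coagGain c a m =
    ∑ ij ∈ Finset.HasAntidiagonal.antidiagonal a, ∑ kl ∈ Finset.HasAntidiagonal.antidiagonal m,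
      ((kl.1 : ℝ) * armFlux c ij.1 kl.1) * armFlux c ij.2 kl.2 := by
  have hswap : ∑ ij ∈ Finset.HasAntidiagonal.antidiagonal a,
      ∑ kl ∈ Finset.HasAntidiagonal.antidiagonal m,
      ((kl.1 : ℝ) * armFlux c ij.1 kl.1) * armFlux c ij.2 kl.2 =
      ∑ ij ∈ Finset.HasAntidiagonal.antidiagonal a,
      ∑ kl ∈ Finset.HasAntidiagonal.antidiagonal m,
      ((kl.2 : ℝ) * armFlux c ij.1 kl.1) * armFlux c ij.2 kl.2 := by
    rw [← Finset.Nat.sum_antidiagonal_swap]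
    refine Finset.sum_congr rfl fun ij _ => ?_
    rw [← Finset.Nat.sum_antidiagonal_swap]
    exact Finset.sum_congr rfl fun kl _ => by simp only [Prod.fst_swap, Prod.snd_swap]; ring
  have hadd : (m : ℝ) * ∑ ij ∈ Finset.HasAntidiagonal.antidiagonal a,
      ∑ kl ∈ Finset.HasAntidiagonal.antidiagonal m, armFlux c ij.1 kl.1 * armFlux c ij.2 kl.2 =
      ∑ ij ∈ Finset.HasAntidiagonal.antidiagonal a,
      ∑ kl ∈ Finset.HasAntidiagonal.antidiagonal m,
      ((kl.1 : ℝ) * armFlux c ij.1 kl.1) * armFlux c ij.2 kl.2 +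
      ∑ ij ∈ Finset.HasAntidiagonal.antidiagonal a,
      ∑ kl ∈ Finset.HasAntidiagonal.antidiagonal m,
      ((kl.2 : ℝ) * armFlux c ij.1 kl.1) * armFlux c ij.2 kl.2 := by
    simp only [Finset.mul_sum, ← Finset.sum_add_distrib]
    refine Finset.sum_congr rfl fun ij _ => Finset.sum_congr rfl fun kl hkl => ?_
    have : (m : ℝ) = kl.1 + kl.2 := by
      exact_mod_cast (Finset.HasAntidiagonal.mem_antidiagonal.1 hkl).symm
    rw [this]; ring
  rw [coagGain_eq_sum_antidiagonal hc]
  linarith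

lemma succ_mul_sum_antidiagonal_eq_transportConv (P : ℕ → ℝ) (i : ℕ) :
    ((i : ℝ) + 1) * (1 / 2 * ∑ kl ∈ Finset.HasAntidiagonal.antidiagonal (i + 1), P kl.1 * P kl.2)
      = transportConv P P i := by
  have h1 : ∑ kl ∈ Finset.HasAntidiagonal.antidiagonal (i + 1), (kl.1 : ℝ) * P kl.1 * P kl.2 =
      transportConv P P i := by
    rw [Finset.Nat.sum_antidiagonal_succ, transportConv]
    simp
  have h2 : ∑ kl ∈ Finset.HasAntidiagonal.antidiagonal (i + 1), (kl.1 : ℝ) * P kl.1 * P kl.2 =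
      ∑ kl ∈ Finset.HasAntidiagonal.antidiagonal (i + 1), (kl.2 : ℝ) * P kl.1 * P kl.2 := by
    rw [← Finset.Nat.sum_antidiagonal_swap]
    exact Finset.sum_congr rfl fun kl _ => by simp only [Prod.fst_swap, Prod.snd_swap]; ring
  have h3 : ((i : ℝ) + 1) *
      ∑ kl ∈ Finset.HasAntidiagonal.antidiagonal (i + 1), P kl.1 * P kl.2 =
      ∑ kl ∈ Finset.HasAntidiagonal.antidiagonal (i + 1), (kl.1 : ℝ) * P kl.1 * P kl.2 +
      ∑ kl ∈ Finset.HasAntidiagonal.antidiagonal (i + 1), (kl.2 : ℝ) * P kl.1 * P kl.2 := by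
    rw [Finset.mul_sum, ← Finset.sum_add_distrib]
    refine Finset.sum_congr rfl fun kl hkl => ?_
    have : (i : ℝ) + 1 = kl.1 + kl.2 := by
      exact_mod_cast (Finset.HasAntidiagonal.mem_antidiagonal.1 hkl).symm
    rw [this]; ring
  linarith

lemma hasSum_antidiagonal {f g : ℕ → ℝ}
    (hf : Summable f) (hg : Summable g) :
    HasSum (fun m => ∑ kl ∈ Finset.HasAntidiagonal.antidiagonal m, f kl.1 * g kl.2)
      ((∑' k, f k) * ∑' k, g k) := by
  have hf' := hf.norm
  have hg' := hg.norm
  rw [tsum_mul_tsum_eq_tsum_sum_antidiagonal_of_summable_norm hf' hg']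
  exact (summable_norm_sum_mul_antidiagonal_of_summable_norm hf' hg').of_norm.hasSum

lemma hasSum_coagGain (hc0 : ∀ a, c a 0 = 0) (hs : ∀ i, Summable (armFlux c i)) (i : ℕ) :
    HasSum (fun m => ((i : ℝ) + 1) * coagGain c (i + 1) m)
      (transportConv (fun i => ∑' m, armFlux c i m) (fun i => ∑' m, armFlux c i m) i) := by
  rw [← succ_mul_sum_antidiagonal_eq_transportConv]
  simp only [coagGain_eq_sum_antidiagonal hc0]
  refine ((hasSum_sum fun ij _ => ?_).mul_left _).mul_left _
  exact hasSum_antidiagonal (hs ij.1) (hs ij.2)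

lemma hasSum_mul_coagGain (hc0 : ∀ a, c a 0 = 0) (hs : ∀ i, Summable (armFlux c i))
    (hm : ∀ a, Summable fun m : ℕ => (m : ℝ) * c a m) (a : ℕ) :
    HasSum (fun m : ℕ => (m : ℝ) * coagGain c a m)
      (transportConv (fun a => ∑' m : ℕ, (m : ℝ) * c a m) (fun i => ∑' m, armFlux c i m) a) := by
  simp only [mul_coagGain_eq hc0, transportConv]
  refine hasSum_sum fun ij _ => ?_
  have h := (hm (ij.1 + 1)).hasSum.mul_left ((ij.1 : ℝ) + 1)
  have h' : HasSum (fun k : ℕ => (k : ℝ) * armFlux c ij.1 k)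
      (((ij.1 : ℝ) + 1) * ∑' m : ℕ, (m : ℝ) * c (ij.1 + 1) m) :=
    h.congr_fun fun k => by simp only [armFlux]; ring
  rw [← h'.tsum_eq]
  exact hasSum_antidiagonal (f := fun k : ℕ => (k : ℝ) * armFlux c ij.1 k) h'.summable (hs ij.2)

lemma sum_mul_coagGain_le (hc : ∀ a m, 0 ≤ c a m) (hc0 : ∀ a, c a 0 = 0)
    (hs : ∀ i, Summable (armFlux c i)) (N a : ℕ) :
    ∑ m ∈ Finset.range N, (m : ℝ) * coagGain c a m ≤
      transportConv (fun a => ∑ m ∈ Finset.range N, (m : ℝ) * c a m)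
        (fun i => ∑' m, armFlux c i m) a := by
  simp only [mul_coagGain_eq hc0, transportConv]
  rw [Finset.sum_comm]
  refine Finset.sum_le_sum fun ij _ => ?_
  have h0 := armFlux_nonneg hc
  refine (sum_antidiagonal_mul_le (f := fun k => (k : ℝ) * armFlux c ij.1 k)
    (fun k => mul_nonneg k.cast_nonneg (h0 _ _)) (h0 ij.2) N).trans ?_
  have e1 : ∑ k ∈ Finset.range N, (k : ℝ) * armFlux c ij.1 k =
      ((ij.1 : ℝ) + 1) * ∑ m ∈ Finset.range N, (m : ℝ) * c (ij.1 + 1) m := by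
    rw [Finset.mul_sum]
    exact Finset.sum_congr rfl fun k _ => by rw [armFlux]; ring
  rw [e1]
  exact mul_le_mul_of_nonneg_left ((hs ij.2).sum_le_tsum _ fun k _ => h0 _ _)
    (mul_nonneg (by positivity) (Finset.sum_nonneg fun m _ => mul_nonneg m.cast_nonneg (hc _ _)))

end GainMoments

/-- A time-changed, loss-free solution of the coagulation equation on `[0, τ₁]`. -/
structure CoagFlow (D : ℝ → ℕ → ℕ → ℝ) (τ₁ : ℝ) : Prop where
  time_nonneg : 0 ≤ τ₁
  nonneg : ∀ τ ∈ Icc 0 τ₁, ∀ a m, 0 ≤ D τ a m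
  mass_zero : ∀ τ ∈ Icc 0 τ₁, ∀ a, D τ a 0 = 0
  cont : ∀ a m, ContinuousOn (fun τ => D τ a m) (Icc 0 τ₁)
  deriv : ∀ τ ∈ Ioo 0 τ₁, ∀ a m, HasDerivAt (fun τ => D τ a m) (coagGain (D τ) a m) τ
  summable : ∀ i, Summable (armFlux (D τ₁) i)

/-- The concentration of clusters from which one arm has been removed, with `i` remaining arms. -/
noncomputable def armMarginal (c : ℕ → ℕ → ℝ) (i : ℕ) : ℝ := ∑' m, armFlux c i m

/-- The mass carried by the clusters with `a` arms. -/
noncomputable def massMarginal (c : ℕ → ℕ → ℝ) (a : ℕ) : ℝ := ∑' m : ℕ, (m : ℝ) * c a m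

lemma coagGain_le_coagGain {c d : ℕ → ℕ → ℝ} (hc : ∀ a m, 0 ≤ c a m) (h : ∀ a m, c a m ≤ d a m)
    (a m : ℕ) : coagGain c a m ≤ coagGain d a m := by
  have hd : ∀ a m, 0 ≤ d a m := fun a m => (hc a m).trans (h a m)
  unfold coagGain
  gcongr with i _ j _
  · exact hc _ _
  · exact mul_nonneg (by positivity) (hd _ _)
  · exact h _ _
  · exact h _ _

namespace CoagFlow

variable {D : ℝ → ℕ → ℕ → ℝ} {τ₁ z w q B M : ℝ}

lemma mono (h : CoagFlow D τ₁) {σ τ : ℝ} (hσ : σ ∈ Icc 0 τ₁) (hτ : τ ∈ Icc 0 τ₁) (hστ : σ ≤ τ)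
    (a m : ℕ) : D σ a m ≤ D τ a m := by
  refine monotoneOn_of_hasDerivWithinAt_nonneg (convex_Icc 0 τ₁) (h.cont a m)
    (f' := fun τ => coagGain (D τ) a m) ?_ ?_ hσ hτ hστ <;> rw [interior_Icc]
  · exact fun τ hτ => (h.deriv τ hτ a m).hasDerivWithinAt
  · exact fun τ hτ => coagGain_nonneg (h.nonneg τ (Ioo_subset_Icc_self hτ)) a m

lemma le_last (h : CoagFlow D τ₁) {τ : ℝ} (hτ : τ ∈ Icc 0 τ₁) (a m : ℕ) :
    D τ a m ≤ D τ₁ a m :=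
  h.mono hτ ⟨h.time_nonneg, le_rfl⟩ hτ.2 a m

lemma summable_armFlux (h : CoagFlow D τ₁) {τ : ℝ} (hτ : τ ∈ Icc 0 τ₁) (i : ℕ) :
    Summable (armFlux (D τ) i) :=
  (h.summable i).of_nonneg_of_le (fun m => armFlux_nonneg (h.nonneg τ hτ) i m) fun m =>
    mul_le_mul_of_nonneg_left (h.le_last hτ _ _) (by positivity)

lemma armMarginal_nonneg (h : CoagFlow D τ₁) {τ : ℝ} (hτ : τ ∈ Icc 0 τ₁) (i : ℕ) :
    0 ≤ armMarginal (D τ) i :=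
  tsum_nonneg fun m => armFlux_nonneg (h.nonneg τ hτ) i m

lemma massMarginal_nonneg (h : CoagFlow D τ₁) {τ : ℝ} (hτ : τ ∈ Icc 0 τ₁) (a : ℕ) :
    0 ≤ massMarginal (D τ) a :=
  tsum_nonneg fun m => mul_nonneg m.cast_nonneg (h.nonneg τ hτ a m)

section Weighted

variable {φ : ℕ → ℝ} {a : ℕ}

lemma norm_weighted_le (h : CoagFlow D τ₁) (hφ : ∀ m, 0 ≤ φ m) {τ : ℝ} (hτ : τ ∈ Icc 0 τ₁)
    (m : ℕ) : ‖φ m * D τ a m‖ ≤ φ m * D τ₁ a m := by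
  rw [Real.norm_of_nonneg (mul_nonneg (hφ m) (h.nonneg τ hτ a m))]
  exact mul_le_mul_of_nonneg_left (h.le_last hτ a m) (hφ m)

lemma continuousOn_weighted (h : CoagFlow D τ₁) (hφ : ∀ m, 0 ≤ φ m)
    (hs : Summable fun m => φ m * D τ₁ a m) :
    ContinuousOn (fun τ => ∑' m, φ m * D τ a m) (Icc 0 τ₁) :=
  continuousOn_tsum (fun m => continuousOn_const.mul (h.cont a m)) hs
    fun m _ hτ => h.norm_weighted_le hφ hτ m

lemma hasDerivAt_weighted (h : CoagFlow D τ₁) (hφ : ∀ m, 0 ≤ φ m)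
    (hs : Summable fun m => φ m * D τ₁ a m)
    (hg : Summable fun m => φ m * coagGain (D τ₁) a m) {τ : ℝ} (hτ : τ ∈ Ioo 0 τ₁) :
    HasDerivAt (fun τ => ∑' m, φ m * D τ a m) (∑' m, φ m * coagGain (D τ) a m) τ := by
  refine hasDerivAt_tsum_of_isPreconnected hg isOpen_Ioo isPreconnected_Ioo
    (fun m σ hσ => (h.deriv σ hσ a m).const_mul (φ m)) (fun m σ hσ => ?_) hτ ?_ hτ
  · have hσ' := Ioo_subset_Icc_self hσ
    rw [Real.norm_of_nonneg (mul_nonneg (hφ m) (coagGain_nonneg (h.nonneg σ hσ') a m))]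
    exact mul_le_mul_of_nonneg_left
      (coagGain_le_coagGain (h.nonneg σ hσ') (h.le_last hσ') a m) (hφ m)
  · exact Summable.of_norm_bounded hs fun m => h.norm_weighted_le hφ (Ioo_subset_Icc_self hτ) m

end Weighted

lemma mem_last (h : CoagFlow D τ₁) : τ₁ ∈ Icc 0 τ₁ := ⟨h.time_nonneg, le_rfl⟩

lemma mem_zero (h : CoagFlow D τ₁) : (0 : ℝ) ∈ Icc 0 τ₁ := ⟨le_rfl, h.time_nonneg⟩

lemma continuousOn_armMarginal (h : CoagFlow D τ₁) (i : ℕ) :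
    ContinuousOn (fun τ => armMarginal (D τ) i) (Icc 0 τ₁) :=
  h.continuousOn_weighted (φ := fun _ => (i : ℝ) + 1) (fun _ => by positivity) (h.summable i)

lemma hasDerivAt_armMarginal (h : CoagFlow D τ₁) {τ : ℝ} (hτ : τ ∈ Ioo 0 τ₁) (i : ℕ) :
    HasDerivAt (fun τ => armMarginal (D τ) i)
      (transportConv (armMarginal (D τ)) (armMarginal (D τ)) i) τ := by
  have hτ' := Ioo_subset_Icc_self hτ
  have h1 := h.hasDerivAt_weighted (φ := fun _ => (i : ℝ) + 1) (fun _ => by positivity)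
    (h.summable i) (hasSum_coagGain (h.mass_zero _ h.mem_last) h.summable i).summable hτ
  exact h1.congr_deriv
    (hasSum_coagGain (h.mass_zero _ hτ') (h.summable_armFlux hτ') i).tsum_eq

lemma summable_mass (h : CoagFlow D τ₁) (hm : ∀ a, Summable fun m : ℕ => (m : ℝ) * D τ₁ a m)
    {τ : ℝ} (hτ : τ ∈ Icc 0 τ₁) (a : ℕ) : Summable fun m : ℕ => (m : ℝ) * D τ a m :=
  Summable.of_norm_bounded (hm a) fun m => h.norm_weighted_le (fun m => m.cast_nonneg) hτ m

lemma continuousOn_massMarginal (h : CoagFlow D τ₁)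
    (hm : ∀ a, Summable fun m : ℕ => (m : ℝ) * D τ₁ a m) (a : ℕ) :
    ContinuousOn (fun τ => massMarginal (D τ) a) (Icc 0 τ₁) :=
  h.continuousOn_weighted (fun m => m.cast_nonneg) (hm a)

lemma hasDerivAt_massMarginal (h : CoagFlow D τ₁)
    (hm : ∀ a, Summable fun m : ℕ => (m : ℝ) * D τ₁ a m) {τ : ℝ} (hτ : τ ∈ Ioo 0 τ₁) (a : ℕ) :
    HasDerivAt (fun τ => massMarginal (D τ) a)
      (transportConv (massMarginal (D τ)) (armMarginal (D τ)) a) τ := by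
  have hτ' := Ioo_subset_Icc_self hτ
  have h1 := h.hasDerivAt_weighted (fun m => m.cast_nonneg) (hm a)
    (hasSum_mul_coagGain (h.mass_zero _ h.mem_last) h.summable hm a).summable hτ
  exact h1.congr_deriv (hasSum_mul_coagGain (h.mass_zero _ hτ') (h.summable_armFlux hτ')
    (h.summable_mass hm hτ') a).tsum_eq

lemma powSum_armMarginal_line (h : CoagFlow D τ₁) (hz : 0 < z) (hB : 0 ≤ B) (hq0 : 0 ≤ q)
    (hq1 : q < 1) (hw : w = powSum (armMarginal (D τ₁)) z)
    (hPb : ∀ τ ∈ Icc 0 τ₁, ∀ a, armMarginal (D τ) a * (z + (τ₁ - τ) * w) ^ a ≤ B * q ^ a) :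
    ∀ τ ∈ Icc 0 τ₁, powSum (armMarginal (D τ)) (z + (τ₁ - τ) * w) = w :=
  powSum_line_self h.time_nonneg hz hB hq0 hq1 (fun _ hτ => h.armMarginal_nonneg hτ) hw hPb
    h.continuousOn_armMarginal fun _ hτ => h.hasDerivAt_armMarginal hτ

lemma powSum_massMarginal (h : CoagFlow D τ₁) (hz : 0 < z) (hB : 0 ≤ B) (hq0 : 0 ≤ q)
    (hq1 : q < 1) (hw : w = powSum (armMarginal (D τ₁)) z)
    (hPb : ∀ τ ∈ Icc 0 τ₁, ∀ a, armMarginal (D τ) a * (z + (τ₁ - τ) * w) ^ a ≤ B * q ^ a)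
    (hm : ∀ a, Summable fun m : ℕ => (m : ℝ) * D τ₁ a m)
    (heb : ∀ τ ∈ Icc 0 τ₁, ∀ a, massMarginal (D τ) a * (z + (τ₁ - τ) * w) ^ a ≤ B * q ^ a) :
    powSum (massMarginal (D τ₁)) z = powSum (massMarginal (D 0)) (z + τ₁ * w) :=
  powSum_line_eq h.time_nonneg hz (hw ▸ powSum_nonneg (h.armMarginal_nonneg h.mem_last) hz.le) hB
    hq0 hq1 (fun _ hτ => h.armMarginal_nonneg hτ) hPb
    (h.powSum_armMarginal_line hz hB hq0 hq1 hw hPb) (fun _ hτ => h.massMarginal_nonneg hτ) heb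
    (h.continuousOn_massMarginal hm) fun _ hτ => h.hasDerivAt_massMarginal hm hτ

lemma sum_range_mass_le (h : CoagFlow D τ₁) {τ : ℝ} (hτ : τ ∈ Icc 0 τ₁) (N i : ℕ) :
    ∑ m ∈ Finset.range N, (m : ℝ) * D τ (i + 1) m ≤ N * armMarginal (D τ) i := by
  have h0 := armFlux_nonneg (h.nonneg τ hτ) i
  calc ∑ m ∈ Finset.range N, (m : ℝ) * D τ (i + 1) m
      ≤ ∑ m ∈ Finset.range N, (N : ℝ) * armFlux (D τ) i m := by
        refine Finset.sum_le_sum fun m hm => mul_le_mul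
          (by exact_mod_cast (Finset.mem_range.1 hm).le) ?_ (h.nonneg τ hτ _ _) N.cast_nonneg
        exact le_mul_of_one_le_left (h.nonneg τ hτ _ _) (by simp)
    _ = N * ∑ m ∈ Finset.range N, armFlux (D τ) i m := by rw [Finset.mul_sum]
    _ ≤ N * armMarginal (D τ) i := mul_le_mul_of_nonneg_left
        ((h.summable_armFlux hτ i).sum_le_tsum _ fun m _ => h0 m) N.cast_nonneg

lemma sum_range_mass_mul_pow_le (h : CoagFlow D τ₁) (hz : 0 < z) (hB : 0 ≤ B) (hq0 : 0 < q)
    (hq1 : q < 1) (hw : w = powSum (armMarginal (D τ₁)) z)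
    (hPb : ∀ τ ∈ Icc 0 τ₁, ∀ a, armMarginal (D τ) a * (z + (τ₁ - τ) * w) ^ a ≤ B * q ^ a)
    (hm0 : ∀ a, Summable fun m : ℕ => (m : ℝ) * D 0 a m) (hM : Summable (massMarginal (D 0)))
    (hZ1 : z + τ₁ * w ≤ 1) (N a : ℕ) :
    (∑ m ∈ Finset.range N, (m : ℝ) * D τ₁ a m) * z ^ a ≤ ∑' a, massMarginal (D 0) a := by
  have hw0 : 0 ≤ w := hw ▸ powSum_nonneg (h.armMarginal_nonneg h.mem_last) hz.le
  set E : ℝ → ℕ → ℝ := fun τ a => ∑ m ∈ Finset.range N, (m : ℝ) * D τ a m with hE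
  have hE0 : ∀ τ ∈ Icc 0 τ₁, ∀ a, 0 ≤ E τ a := fun τ hτ a =>
    Finset.sum_nonneg fun m _ => mul_nonneg m.cast_nonneg (h.nonneg τ hτ a m)
  set B' : ℝ := B + N * B / q + E τ₁ 0 with hB'
  have hB1 : B ≤ B' := by
    have := hE0 τ₁ h.mem_last 0
    have : 0 ≤ N * B / q := by positivity
    linarith
  have hB2 : N * B / q ≤ B' := by
    have := hE0 τ₁ h.mem_last 0
    linarith
  have hB3 : E τ₁ 0 ≤ B' := by
    have : 0 ≤ N * B / q := by positivity
    linarith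
  have hZ0 : ∀ τ ∈ Icc 0 τ₁, 0 ≤ z + (τ₁ - τ) * w := fun τ hτ => hz.le.trans (line_ge hw0 hτ.2)
  have hZle : ∀ τ ∈ Icc 0 τ₁, z + (τ₁ - τ) * w ≤ 1 := fun τ hτ => by
    have := mul_nonneg hτ.1 hw0
    linarith
  have hPb' : ∀ τ ∈ Icc 0 τ₁, ∀ a,
      armMarginal (D τ) a * (z + (τ₁ - τ) * w) ^ a ≤ B' * q ^ a := fun τ hτ a =>
    (hPb τ hτ a).trans (mul_le_mul_of_nonneg_right hB1 (by positivity))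
  have hEb : ∀ τ ∈ Icc 0 τ₁, ∀ a, E τ a * (z + (τ₁ - τ) * w) ^ a ≤ B' * q ^ a := by
    intro τ hτ a
    rcases a with _ | i
    · simp only [pow_zero, mul_one]
      refine le_trans (Finset.sum_le_sum fun m _ => ?_) hB3
      exact mul_le_mul_of_nonneg_left (h.le_last hτ 0 m) m.cast_nonneg
    · have hn : 0 ≤ armMarginal (D τ) i * (z + (τ₁ - τ) * w) ^ i :=
        mul_nonneg (h.armMarginal_nonneg hτ i) (pow_nonneg (hZ0 τ hτ) i)
      calc E τ (i + 1) * (z + (τ₁ - τ) * w) ^ (i + 1)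
          ≤ (N * armMarginal (D τ) i) * (z + (τ₁ - τ) * w) ^ (i + 1) :=
            mul_le_mul_of_nonneg_right (h.sum_range_mass_le hτ N i) (pow_nonneg (hZ0 τ hτ) _)
        _ = N * (armMarginal (D τ) i * (z + (τ₁ - τ) * w) ^ i) * (z + (τ₁ - τ) * w) := by ring
        _ ≤ N * (armMarginal (D τ) i * (z + (τ₁ - τ) * w) ^ i) * 1 :=
            mul_le_mul_of_nonneg_left (hZle τ hτ) (mul_nonneg N.cast_nonneg hn)
        _ ≤ N * (B * q ^ i) := by
            rw [mul_one]
            exact mul_le_mul_of_nonneg_left (hPb τ hτ i) N.cast_nonneg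
        _ = N * B / q * q ^ (i + 1) := by rw [pow_succ]; field_simp
        _ ≤ B' * q ^ (i + 1) := mul_le_mul_of_nonneg_right hB2 (by positivity)
  have hline := powSum_line_le h.time_nonneg hz hw0 (hB.trans hB1) hq0.le hq1
    (fun τ hτ => h.armMarginal_nonneg hτ) hPb'
    (h.powSum_armMarginal_line hz hB hq0.le hq1 hw hPb) hE0 hEb
    (fun a => continuousOn_finsetSum _ fun m _ => continuousOn_const.mul (h.cont a m))
    (r := fun τ a => ∑ m ∈ Finset.range N, (m : ℝ) * coagGain (D τ) a m)
    (fun τ hτ a => Finset.sum_nonneg fun m _ => mul_nonneg m.cast_nonneg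
      (coagGain_nonneg (h.nonneg τ (Ioo_subset_Icc_self hτ)) a m))
    (fun τ hτ a => sum_mul_coagGain_le (h.nonneg τ (Ioo_subset_Icc_self hτ))
      (h.mass_zero τ (Ioo_subset_Icc_self hτ)) (h.summable_armFlux (Ioo_subset_Icc_self hτ)) N a)
    (fun τ hτ a => HasDerivAt.fun_sum fun m _ => (h.deriv τ hτ a m).const_mul _)
  have hsum : Summable fun a => E τ₁ a * z ^ a := by
    have hb := hEb τ₁ h.mem_last
    simp only [sub_self, zero_mul, add_zero] at hb
    exact Summable.of_nonneg_of_le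
      (fun a => mul_nonneg (hE0 _ h.mem_last a) (pow_nonneg hz.le a)) hb
      ((summable_geometric_of_lt_one hq0.le hq1).mul_left B')
  refine (hsum.le_tsum a fun b _ =>
    mul_nonneg (hE0 _ h.mem_last b) (pow_nonneg hz.le b)).trans (hline.trans ?_)
  have hle : ∀ a, E 0 a * (z + τ₁ * w) ^ a ≤ massMarginal (D 0) a := fun a =>
    (mul_le_of_le_one_right (hE0 0 h.mem_zero a) (pow_le_one₀
      (add_nonneg hz.le (mul_nonneg h.time_nonneg hw0)) hZ1)).trans
      ((hm0 a).sum_le_tsum _ fun m _ => mul_nonneg m.cast_nonneg (h.nonneg 0 h.mem_zero a m))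
  exact (Summable.of_nonneg_of_le (fun a => mul_nonneg (hE0 0 h.mem_zero a) (pow_nonneg
    (add_nonneg hz.le (mul_nonneg h.time_nonneg hw0)) a)) hle hM).tsum_le_tsum hle hM

end CoagFlow

/-- The intrinsic clock of a solution. -/
noncomputable def clock (c : ℝ → ℕ → ℕ → ℝ) (t : ℝ) : ℝ := ∫ r in (0:ℝ)..t, clockRate c r

/-- The number of arms with the aggregation losses compensated. -/
noncomputable def scaledArm (c : ℝ → ℕ → ℕ → ℝ) (t : ℝ) : ℝ := Real.exp t * armSum (c t)

/-- The foot at time `0` of the characteristic ending at `exp (-t)` at time `t`. -/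
noncomputable def characteristicFoot (c : ℝ → ℕ → ℕ → ℝ) (t : ℝ) : ℝ :=
  Real.exp (-t) + clock c t * scaledArm c t

lemma lossless_zero (c : ℝ → ℕ → ℕ → ℝ) : lossless c 0 = c 0 := by
  ext a m; simp [lossless]

namespace IsModifiedSmoluchowskiSolution

variable {c : ℝ → ℕ → ℕ → ℝ} {c₀ : ℕ → ℕ → ℝ} {s t T z : ℝ}

lemma scaledArm_pos (hc : IsModifiedSmoluchowskiSolution c c₀) (ht : 0 ≤ t) :
    0 < scaledArm c t := mul_pos (Real.exp_pos t) (hc.arm_pos ht)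

lemma clockRate_eq (hc : IsModifiedSmoluchowskiSolution c c₀) (ht : 0 ≤ t) :
    clockRate c t = Real.exp (-t) / scaledArm c t := by
  have := (hc.arm_pos ht).ne'
  have := (Real.exp_pos t).ne'
  rw [clockRate, scaledArm, Real.exp_neg]
  field_simp

lemma intervalIntegrable_clockRate (hc : IsModifiedSmoluchowskiSolution c c₀) (hT : 0 ≤ T) :
    IntervalIntegrable (clockRate c) volume 0 T := by
  have h := (hc.intervalIntegrable_inv_arm le_rfl hT).mul_continuousOn
    (g := fun t => (Real.exp t ^ 2)⁻¹)
    (by fun_prop (disch := intros; positivity))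
  refine h.congr fun t _ => ?_
  rw [clockRate, mul_inv, mul_comm]

lemma exists_le_clockRate (hc : IsModifiedSmoluchowskiSolution c c₀) (hT : 0 ≤ T) :
    ∃ b, 0 < b ∧ ∀ s ∈ Icc 0 T, b ≤ clockRate c s := by
  obtain ⟨_, B, _, h⟩ := hc.exists_arm_bounds hT
  have hB : 0 < B := (hc.arm_pos hT).trans_le (h T ⟨hT, le_rfl⟩).2
  refine ⟨(Real.exp T ^ 2 * B)⁻¹, by positivity, fun s hs => ?_⟩
  have := hc.arm_pos hs.1
  rw [clockRate]
  gcongr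
  · exact hs.2
  · exact (h s hs).2

lemma le_clock_sub (hc : IsModifiedSmoluchowskiSolution c c₀) (hs : 0 ≤ s) (hst : s ≤ t) :
    Real.exp (-s) - Real.exp (-t) ≤ (clock c t - clock c s) * scaledArm c s := by
  have hint := hc.intervalIntegrable_clockRate (hs.trans hst)
  have hsm : s ∈ Icc 0 t := ⟨hs, hst⟩
  have htm : t ∈ Icc 0 t := ⟨hs.trans hst, le_rfl⟩
  have e : (∫ r in s..t, Real.exp (-r)) = Real.exp (-s) - Real.exp (-t) := by
    rw [integral_comp_neg, integral_exp]
  rw [clock, clock, clock_sub hint hsm htm, ← intervalIntegral.integral_mul_const, ← e]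
  refine integral_mono_on hst (Continuous.intervalIntegrable (by fun_prop) _ _)
    ((intervalIntegrable_of_mem_Icc hint hsm htm).mul_const _) fun r hr => ?_
  rw [hc.clockRate_eq (hs.trans hr.1), div_mul_eq_mul_div, le_div_iff₀
    (hc.scaledArm_pos (hs.trans hr.1))]
  exact mul_le_mul_of_nonneg_left (hc.exp_mul_arm_le hs hr.1) (Real.exp_pos _).le

lemma clock_sub_le (hc : IsModifiedSmoluchowskiSolution c c₀) (hs : 0 ≤ s) (hst : s ≤ t) :
    (clock c t - clock c s) * scaledArm c t ≤ Real.exp (-s) - Real.exp (-t) := by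
  have hint := hc.intervalIntegrable_clockRate (hs.trans hst)
  have hsm : s ∈ Icc 0 t := ⟨hs, hst⟩
  have htm : t ∈ Icc 0 t := ⟨hs.trans hst, le_rfl⟩
  have e : (∫ r in s..t, Real.exp (-r)) = Real.exp (-s) - Real.exp (-t) := by
    rw [integral_comp_neg, integral_exp]
  rw [clock, clock, clock_sub hint hsm htm, ← intervalIntegral.integral_mul_const, ← e]
  refine integral_mono_on hst ((intervalIntegrable_of_mem_Icc hint hsm htm).mul_const _)
    (Continuous.intervalIntegrable (by fun_prop) _ _) fun r hr => ?_
  rw [hc.clockRate_eq (hs.trans hr.1), div_mul_eq_mul_div, div_le_iff₀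
    (hc.scaledArm_pos (hs.trans hr.1))]
  exact mul_le_mul_of_nonneg_left (hc.exp_mul_arm_le (hs.trans hr.1) hr.2) (Real.exp_pos _).le

lemma clock_le (hc : IsModifiedSmoluchowskiSolution c c₀) (hs : 0 ≤ s) (hst : s ≤ t) :
    clock c s ≤ clock c t := by
  have h1 := hc.le_clock_sub hs hst
  have h2 : Real.exp (-t) ≤ Real.exp (-s) := Real.exp_le_exp.2 (by linarith)
  have h3 := nonneg_of_mul_nonneg_left ((sub_nonneg.2 h2).trans h1) (hc.scaledArm_pos hs)
  linarith

lemma clock_nonneg (hc : IsModifiedSmoluchowskiSolution c c₀) (ht : 0 ≤ t) : 0 ≤ clock c t := by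
  simpa [clock] using hc.clock_le le_rfl ht

lemma lossless_nonneg (hc : IsModifiedSmoluchowskiSolution c c₀) (ht : 0 ≤ t) (a m : ℕ) :
    0 ≤ lossless c t a m := mul_nonneg (by positivity) (hc.nonneg ht a m)

lemma hasSum_armMarginal (hc : IsModifiedSmoluchowskiSolution c c₀) (ht : 0 ≤ t) :
    HasSum (fun i => armMarginal (lossless c t) i * Real.exp (-t) ^ i) (scaledArm c t) := by
  have h := hasSum_armFlux (hc.summable_arm ht)
  refine (h.mul_left (Real.exp t)).prod_fiberwise fun i => ?_
  have h1 := ((h.summable.prod_factor i).hasSum).mul_left (Real.exp t)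
  convert h1 using 1
  have : ∀ m, armFlux (lossless c t) i m = Real.exp t ^ (i + 1) * armFlux (c t) i m := fun m => by
    simp only [armFlux, lossless]; ring
  rw [armMarginal, tsum_congr this, tsum_mul_left, Real.exp_neg, inv_pow, pow_succ]
  have := (Real.exp_pos t).ne'
  field_simp

lemma summable_armFlux_lossless (hc : IsModifiedSmoluchowskiSolution c c₀) (ht : 0 ≤ t) (i : ℕ) :
    Summable (armFlux (lossless c t) i) := by
  refine (((hasSum_armFlux (hc.summable_arm ht)).summable.prod_factor i).mul_left
    (Real.exp t ^ (i + 1))).congr fun m => ?_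
  simp only [armFlux, lossless]; ring

lemma armMarginal_nonneg (hc : IsModifiedSmoluchowskiSolution c c₀) (ht : 0 ≤ t) (i : ℕ) :
    0 ≤ armMarginal (lossless c t) i :=
  tsum_nonneg fun m => armFlux_nonneg (hc.lossless_nonneg ht) i m

lemma exists_coagFlow (hc : IsModifiedSmoluchowskiSolution c c₀) (hT : 0 ≤ T) :
    ∃ θ : ℝ → ℝ, CoagFlow (fun τ => lossless c (θ τ)) (clock c T) ∧
      (∀ τ ∈ Icc 0 (clock c T), θ τ ∈ Icc 0 T ∧ clock c (θ τ) = τ) ∧ θ 0 = 0 ∧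
      θ (clock c T) = T := by
  have hβ := hc.intervalIntegrable_clockRate hT
  obtain ⟨b, hb, hbβ⟩ := hc.exists_le_clockRate hT
  obtain ⟨θ, hθ, hθc, hθ0, hθT⟩ := exists_clock_inverse hT hβ hb hbβ
  have hmap : MapsTo θ (Icc 0 (clock c T)) (Ici 0) := fun τ hτ => (hθ τ hτ).1.1
  refine ⟨θ, ⟨hc.clock_nonneg hT, fun τ hτ => hc.lossless_nonneg (hmap hτ), fun τ hτ a => ?_,
    fun a m => ?_, fun τ hτ a m => ?_, fun i => ?_⟩, hθ, hθ0, hθT⟩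
  · simp [lossless, hc.mass_zero (hmap hτ)]
  · exact ((Real.continuous_exp.comp_continuousOn hθc).pow a).mul
      ((hc.continuousOn a m).comp hθc hmap)
  · refine hasDerivAt_comp_clock_inverse hβ (fun s hs => hb.le.trans (hbβ s hs))
      (f := fun t => lossless c t a m) (Q := fun t => coagGain (lossless c t) a m)
      (fun t ht => hc.lossless_eq_integral ht.1 a m) ?_ hθ hθc hτ
    have h : ∀ t, coagGain (lossless c t) a m = _ := fun t =>
      coagGain_pow_mul (c t) (Real.exp t) a m
    simp only [h]
    exact ((Real.continuous_exp.pow _).continuousOn.mul (hc.continuousOn_coagGain a m)).mono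
      Icc_subset_Ici_self
  · rw [show θ (clock c T) = T from hθT]
    exact hc.summable_armFlux_lossless hT i

lemma exists_contraction_factor (hT : 0 ≤ T) (hz : 0 < z) (hzT : z < Real.exp (-T)) :
    ∃ q : ℝ, 0 < q ∧ q < 1 ∧ q = 1 - (Real.exp (-T) - z) := by
  have : Real.exp (-T) ≤ 1 := Real.exp_le_one_iff.2 (by linarith)
  exact ⟨_, by linarith, by linarith, rfl⟩

lemma hasSum_armMarginal_mul_pow
    (hc : IsModifiedSmoluchowskiSolution c c₀) (hT : 0 ≤ T) (hz : 0 < z)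
    (hzT : z < Real.exp (-T)) :
    HasSum (fun i => armMarginal (lossless c T) i * z ^ i)
    (powSum (armMarginal (lossless c T)) z) :=
  (Summable.of_nonneg_of_le
    (fun i => mul_nonneg (hc.armMarginal_nonneg hT i) (pow_nonneg hz.le i))
    (fun i => mul_le_mul_of_nonneg_left (pow_le_pow_left₀ hz.le hzT.le i)
      (hc.armMarginal_nonneg hT i)) (hc.hasSum_armMarginal hT).summable).hasSum

lemma powSum_armMarginal_le
    (hc : IsModifiedSmoluchowskiSolution c c₀) (hT : 0 ≤ T) (hz : 0 < z)
    (hzT : z < Real.exp (-T)) :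
    powSum (armMarginal (lossless c T)) z ≤ scaledArm c T :=
  hasSum_le (fun i => mul_le_mul_of_nonneg_left (pow_le_pow_left₀ hz.le hzT.le i)
      (hc.armMarginal_nonneg hT i)) (hc.hasSum_armMarginal_mul_pow hT hz hzT)
    (hc.hasSum_armMarginal hT)

lemma line_le
    (hc : IsModifiedSmoluchowskiSolution c c₀) (hT : 0 ≤ T) (hz : 0 < z)
    (hzT : z < Real.exp (-T)) (hs : s ∈ Icc 0 T) :
    z + (clock c T - clock c s) * powSum (armMarginal (lossless c T)) z ≤
      (1 - (Real.exp (-T) - z)) * Real.exp (-s) := by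
  have h1 := hc.clock_sub_le hs.1 hs.2
  have h2 := mul_le_mul_of_nonneg_left (hc.powSum_armMarginal_le hT hz hzT)
    (sub_nonneg.2 (hc.clock_le hs.1 hs.2))
  have h3 : Real.exp (-s) ≤ 1 := Real.exp_le_one_iff.2 (by linarith [hs.1])
  nlinarith

lemma line_mem
    (hc : IsModifiedSmoluchowskiSolution c c₀) (hT : 0 ≤ T) (hz : 0 < z)
    (hzT : z < Real.exp (-T)) :
    z + clock c T * powSum (armMarginal (lossless c T)) z ∈ Icc (0 : ℝ) 1 := by
  have h := hc.line_le hT hz hzT (s := 0) ⟨le_rfl, hT⟩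
  have h0 := mul_nonneg (hc.clock_nonneg hT) (powSum_nonneg (hc.armMarginal_nonneg hT) hz.le)
  simp only [clock, integral_same, sub_zero, neg_zero, Real.exp_zero, mul_one] at h h0 ⊢
  exact ⟨by linarith, by linarith⟩

lemma mul_line_pow_le
    (hc : IsModifiedSmoluchowskiSolution c c₀) (hT : 0 ≤ T) (hz : 0 < z)
    (hzT : z < Real.exp (-T)) {f : ℕ → ℝ} {B : ℝ} (hs : s ∈ Icc 0 T) (hf : ∀ a, 0 ≤ f a)
    (hfB : ∀ a, f a * Real.exp (-s) ^ a ≤ B) (a : ℕ) :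
    f a * (z + (clock c T - clock c s) * powSum (armMarginal (lossless c T)) z) ^ a ≤
      B * (1 - (Real.exp (-T) - z)) ^ a := by
  have h0 : 0 ≤ z + (clock c T - clock c s) * powSum (armMarginal (lossless c T)) z :=
    add_nonneg hz.le (mul_nonneg (sub_nonneg.2 (hc.clock_le hs.1 hs.2))
      (powSum_nonneg (hc.armMarginal_nonneg hT) hz.le))
  have hq : 0 ≤ 1 - (Real.exp (-T) - z) := by
    have : Real.exp (-T) ≤ 1 := Real.exp_le_one_iff.2 (by linarith)
    linarith
  refine (mul_le_mul_of_nonneg_left (pow_le_pow_left₀ h0 (hc.line_le hT hz hzT hs) a)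
    (hf a)).trans ?_
  rw [mul_pow, mul_left_comm, mul_comm B]
  exact mul_le_mul_of_nonneg_left (hfB a) (pow_nonneg hq a)

lemma armMarginal_mul_line_pow_le
    (hc : IsModifiedSmoluchowskiSolution c c₀) (hT : 0 ≤ T) (hz : 0 < z)
    (hzT : z < Real.exp (-T)) (hs : s ∈ Icc 0 T) (a : ℕ) :
    armMarginal (lossless c s) a *
      (z + (clock c T - clock c s) * powSum (armMarginal (lossless c T)) z) ^ a ≤
      scaledArm c 0 * (1 - (Real.exp (-T) - z)) ^ a := by
  refine hc.mul_line_pow_le hT hz hzT hs (hc.armMarginal_nonneg hs.1) (fun a => ?_) a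
  exact (le_hasSum (hc.hasSum_armMarginal hs.1) a fun b _ =>
    mul_nonneg (hc.armMarginal_nonneg hs.1 b) (by positivity)).trans
    (hc.exp_mul_arm_le le_rfl hs.1)

/-- The generating function of the arms is obtained from the initial one by an implicit equation. -/
lemma powSum_armMarginal_eq
    (hc : IsModifiedSmoluchowskiSolution c c₀) (hT : 0 ≤ T) (hz : 0 < z)
    (hzT : z < Real.exp (-T)) :
    powSum (armMarginal (lossless c T)) z =
    powSum (armMarginal (c 0)) (z + clock c T * powSum (armMarginal (lossless c T)) z) := by
  obtain ⟨θ, hflow, hθ, hθ0, hθT⟩ := hc.exists_coagFlow hT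
  obtain ⟨q, hq0, hq1, hq⟩ := exists_contraction_factor hT hz hzT
  have h := hflow.powSum_armMarginal_line hz (hc.scaledArm_pos le_rfl).le hq0.le hq1
    (w := powSum (armMarginal (lossless c T)) z) (by rw [hθT]) (fun τ hτ a => ?_) 0 hflow.mem_zero
  · simpa [hθ0, lossless_zero, eq_comm] using h
  · have := hc.armMarginal_mul_line_pow_le hT hz hzT (hθ τ hτ).1 a
    rwa [(hθ τ hτ).2, ← hq] at this

lemma sum_range_lossless_mul_pow_le
    (hc : IsModifiedSmoluchowskiSolution c c₀) (hT : 0 ≤ T) (hz : 0 < z)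
    (hzT : z < Real.exp (-T))
    (hsum : Summable fun p : ℕ × ℕ => (p.2 : ℝ) * c 0 p.1 p.2) (N a : ℕ) :
    (∑ m ∈ Finset.range N, (m : ℝ) * lossless c T a m) * z ^ a ≤ massSum (c 0) := by
  obtain ⟨θ, hflow, hθ, hθ0, hθT⟩ := hc.exists_coagFlow hT
  obtain ⟨q, hq0, hq1, hq⟩ := exists_contraction_factor hT hz hzT
  have hZ := hc.line_mem hT hz hzT
  have hD0 : lossless c (θ 0) = c 0 := by rw [hθ0, lossless_zero]
  have h := hflow.sum_range_mass_mul_pow_le hz (hc.scaledArm_pos le_rfl).le hq0 hq1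
    (w := powSum (armMarginal (lossless c T)) z) (by rw [hθT]) (fun τ hτ a => ?_)
    (by simp only [hD0]; exact fun a => hsum.prod_factor a)
    (by simp only [hD0]; exact hsum.prod) hZ.2 N a
  · simp only [hθT, hD0] at h
    rwa [massSum, hsum.tsum_prod]
  · have := hc.armMarginal_mul_line_pow_le hT hz hzT (hθ τ hτ).1 a
    rwa [(hθ τ hτ).2, ← hq] at this

lemma sum_range_mass_le (hc : IsModifiedSmoluchowskiSolution c c₀) (hT : 0 ≤ T)
    (hsum : Summable fun p : ℕ × ℕ => (p.2 : ℝ) * c 0 p.1 p.2) (N a : ℕ) :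
    (∑ m ∈ Finset.range N, (m : ℝ) * lossless c T a m) * Real.exp (-T) ^ a ≤ massSum (c 0) := by
  have ht : Tendsto (fun z : ℝ => (∑ m ∈ Finset.range N, (m : ℝ) * lossless c T a m) * z ^ a)
      (𝓝[<] (Real.exp (-T))) (𝓝 ((∑ m ∈ Finset.range N, (m : ℝ) * lossless c T a m) *
        Real.exp (-T) ^ a)) :=
    (Continuous.tendsto (by fun_prop) _).mono_left nhdsWithin_le_nhds
  refine le_of_tendsto ht ?_
  filter_upwards [Ioo_mem_nhdsLT (Real.exp_pos (-T))] with z hz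
  exact hc.sum_range_lossless_mul_pow_le hT hz.1 hz.2 hsum N a

lemma summable_mass_lossless (hc : IsModifiedSmoluchowskiSolution c c₀) (hT : 0 ≤ T)
    (hsum : Summable fun p : ℕ × ℕ => (p.2 : ℝ) * c 0 p.1 p.2) (a : ℕ) :
    Summable fun m : ℕ => (m : ℝ) * lossless c T a m := by
  refine summable_of_sum_range_le (c := massSum (c 0) / Real.exp (-T) ^ a)
    (fun m => mul_nonneg m.cast_nonneg (hc.lossless_nonneg hT a m)) fun N => ?_
  rw [le_div_iff₀ (by positivity)]
  exact hc.sum_range_mass_le hT hsum N a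

lemma massMarginal_nonneg (hc : IsModifiedSmoluchowskiSolution c c₀) (hT : 0 ≤ T) (a : ℕ) :
    0 ≤ massMarginal (lossless c T) a :=
  tsum_nonneg fun m => mul_nonneg m.cast_nonneg (hc.lossless_nonneg hT a m)

lemma massMarginal_mul_pow_le (hc : IsModifiedSmoluchowskiSolution c c₀) (hT : 0 ≤ T)
    (hsum : Summable fun p : ℕ × ℕ => (p.2 : ℝ) * c 0 p.1 p.2) (a : ℕ) :
    massMarginal (lossless c T) a * Real.exp (-T) ^ a ≤ massSum (c 0) := by
  rw [← le_div_iff₀ (by positivity)]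
  refine Real.tsum_le_of_sum_range_le
    (fun m => mul_nonneg m.cast_nonneg (hc.lossless_nonneg hT a m)) fun N => ?_
  rw [le_div_iff₀ (by positivity)]
  exact hc.sum_range_mass_le hT hsum N a

/-- The generating function of the mass is transported along the same characteristics. -/
lemma powSum_massMarginal_eq (hc : IsModifiedSmoluchowskiSolution c c₀) (hT : 0 ≤ T) (hz : 0 < z)
    (hzT : z < Real.exp (-T)) (hsum : Summable fun p : ℕ × ℕ => (p.2 : ℝ) * c 0 p.1 p.2) :
    powSum (massMarginal (lossless c T)) z =
      powSum (massMarginal (c 0)) (z + clock c T * powSum (armMarginal (lossless c T)) z) := by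
  obtain ⟨θ, hflow, hθ, hθ0, hθT⟩ := hc.exists_coagFlow hT
  obtain ⟨q, hq0, hq1, hq⟩ := exists_contraction_factor hT hz hzT
  have hD0 : lossless c (θ 0) = c 0 := by rw [hθ0, lossless_zero]
  have h := hflow.powSum_massMarginal hz
    ((hc.scaledArm_pos le_rfl).le.trans (le_max_left _ (massSum (c 0)))) hq0.le hq1
    (w := powSum (armMarginal (lossless c T)) z) (by rw [hθT]) (fun τ hτ a => ?_)
    (by simp only [hθT]; exact hc.summable_mass_lossless hT hsum) (fun τ hτ a => ?_)
  · simpa only [hθT, hD0] using h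
  · have := hc.armMarginal_mul_line_pow_le hT hz hzT (hθ τ hτ).1 a
    rw [(hθ τ hτ).2, ← hq] at this
    exact this.trans (mul_le_mul_of_nonneg_right (le_max_left _ _) (by positivity))
  · have := hc.mul_line_pow_le hT hz hzT (hθ τ hτ).1 (hc.massMarginal_nonneg (hθ τ hτ).1.1)
      (hc.massMarginal_mul_pow_le (hθ τ hτ).1.1 hsum) a
    rw [(hθ τ hτ).2, ← hq] at this
    exact this.trans (mul_le_mul_of_nonneg_right (le_max_right _ _) (by positivity))

end IsModifiedSmoluchowskiSolution

section Abel

variable {f : ℕ → ℝ} {y : ℝ}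

lemma summable_mul_pow_of_powSum_le {M : ℝ} (hf : ∀ a, 0 ≤ f a) (hy : 0 < y)
    (h : ∀ z, 0 < z → z < y → Summable (fun a => f a * z ^ a) ∧ powSum f z ≤ M) :
    Summable fun a => f a * y ^ a := by
  refine summable_of_sum_range_le (c := M) (fun a => mul_nonneg (hf a) (pow_nonneg hy.le a))
    fun n => ?_
  have ht : Tendsto (fun z : ℝ => ∑ a ∈ Finset.range n, f a * z ^ a) (𝓝[<] y)
      (𝓝 (∑ a ∈ Finset.range n, f a * y ^ a)) :=
    (Continuous.tendsto (by fun_prop) _).mono_left nhdsWithin_le_nhds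
  refine le_of_tendsto ht ?_
  filter_upwards [Ioo_mem_nhdsLT hy] with z hz
  obtain ⟨h1, h2⟩ := h z hz.1 hz.2
  exact (h1.sum_le_tsum _ fun a _ => mul_nonneg (hf a) (pow_nonneg hz.1.le a)).trans h2

lemma tendsto_powSum_nhdsLT (hf : ∀ a, 0 ≤ f a) (hy : 0 < y)
    (hs : Summable fun a => f a * y ^ a) :
    Tendsto (powSum f) (𝓝[<] y) (𝓝 (powSum f y)) := by
  have hcont : ContinuousOn (powSum f) (Icc 0 y) :=
    continuousOn_tsum (fun a => by fun_prop) hs fun a x hx => by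
      rw [Real.norm_of_nonneg (mul_nonneg (hf a) (pow_nonneg hx.1 a))]
      exact mul_le_mul_of_nonneg_left (pow_le_pow_left₀ hx.1 hx.2 a) (hf a)
  refine (hcont y ⟨hy.le, le_rfl⟩).mono_left ?_
  rw [← nhdsWithin_Ioo_eq_nhdsLT hy]
  exact nhdsWithin_mono y Ioo_subset_Icc_self

end Abel

namespace IsModifiedSmoluchowskiSolution

variable {c : ℝ → ℕ → ℕ → ℝ} {c₀ : ℕ → ℕ → ℝ} {s t T z : ℝ}

lemma powSum_armMarginal_exp (hc : IsModifiedSmoluchowskiSolution c c₀) (hT : 0 ≤ T) :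
    powSum (armMarginal (lossless c T)) (Real.exp (-T)) = scaledArm c T :=
  (hc.hasSum_armMarginal hT).tsum_eq

lemma characteristicFoot_mem (hc : IsModifiedSmoluchowskiSolution c c₀) (hT : 0 ≤ T) :
    characteristicFoot c T ∈ Icc (0 : ℝ) 1 := by
  have h1 := hc.clock_sub_le le_rfl hT
  have h2 := mul_nonneg (hc.clock_nonneg hT) (hc.scaledArm_pos hT).le
  have h3 := Real.exp_pos (-T)
  have h0 : clock c 0 = 0 := by simp [clock]
  rw [h0, neg_zero, Real.exp_zero, sub_zero] at h1
  constructor <;> rw [characteristicFoot] <;> linarith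

lemma summable_armMarginal_initial (hc : IsModifiedSmoluchowskiSolution c c₀) :
    Summable (armMarginal (c 0)) := by
  simpa [lossless_zero] using (hc.hasSum_armMarginal le_rfl).summable

lemma armMarginal_initial_nonneg (hc : IsModifiedSmoluchowskiSolution c c₀) (i : ℕ) :
    0 ≤ armMarginal (c 0) i := by
  simpa [lossless_zero] using hc.armMarginal_nonneg le_rfl i

lemma massMarginal_initial_nonneg (hc : IsModifiedSmoluchowskiSolution c c₀) (a : ℕ) :
    0 ≤ massMarginal (c 0) a := by
  simpa [lossless_zero] using hc.massMarginal_nonneg le_rfl a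

lemma tendsto_line (hc : IsModifiedSmoluchowskiSolution c c₀) (hT : 0 ≤ T) :
    Tendsto (fun z => z + clock c T * powSum (armMarginal (lossless c T)) z)
      (𝓝[<] (Real.exp (-T))) (𝓝 (characteristicFoot c T)) := by
  have h := tendsto_powSum_nhdsLT (hc.armMarginal_nonneg hT) (Real.exp_pos (-T))
    (hc.hasSum_armMarginal hT).summable
  rw [hc.powSum_armMarginal_exp hT] at h
  exact (tendsto_id.mono_left nhdsWithin_le_nhds).add (h.const_mul _)

lemma tendsto_powSum_line (hc : IsModifiedSmoluchowskiSolution c c₀) (hT : 0 ≤ T) {f : ℕ → ℝ}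
    (hf : ∀ a, 0 ≤ f a) (hs : Summable f) :
    Tendsto (fun z => powSum f (z + clock c T * powSum (armMarginal (lossless c T)) z))
      (𝓝[<] (Real.exp (-T))) (𝓝 (powSum f (characteristicFoot c T))) := by
  refine (continuousOn_powSum hf hs _ (hc.characteristicFoot_mem hT)).tendsto.comp
    (tendsto_nhdsWithin_iff.2 ⟨hc.tendsto_line hT, ?_⟩)
  filter_upwards [Ioo_mem_nhdsLT (Real.exp_pos (-T))] with z hz
  exact hc.line_mem hT hz.1 hz.2

lemma scaledArm_eq_powSum (hc : IsModifiedSmoluchowskiSolution c c₀) (hT : 0 ≤ T) :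
    scaledArm c T = powSum (armMarginal (c 0)) (characteristicFoot c T) := by
  have h := tendsto_powSum_nhdsLT (hc.armMarginal_nonneg hT) (Real.exp_pos (-T))
    (hc.hasSum_armMarginal hT).summable
  rw [hc.powSum_armMarginal_exp hT] at h
  refine tendsto_nhds_unique h ((hc.tendsto_powSum_line hT hc.armMarginal_initial_nonneg
    hc.summable_armMarginal_initial).congr' ?_)
  filter_upwards [Ioo_mem_nhdsLT (Real.exp_pos (-T))] with z hz
  exact (hc.powSum_armMarginal_eq hT hz.1 hz.2).symm

/-- The phase `x - α p(x)` stays below its value at the foot. -/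
lemma phase_lt_of_lt_foot (hc : IsModifiedSmoluchowskiSolution c c₀) (hT : 0 ≤ T) {x : ℝ}
    (hx : 0 ≤ x) (hxT : x < characteristicFoot c T) :
    x - clock c T * powSum (armMarginal (c 0)) x < Real.exp (-T) := by
  by_contra! hle
  have hfoot := hc.characteristicFoot_mem hT
  obtain ⟨z, hzx, hz⟩ := (((hc.tendsto_line hT).eventually (lt_mem_nhds hxT)).and
    (Ioo_mem_nhdsLT (Real.exp_pos (-T)))).exists
  set H := z + clock c T * powSum (armMarginal (lossless c T)) z with hH
  have hHeq : powSum (armMarginal (lossless c T)) z = powSum (armMarginal (c 0)) H :=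
    hc.powSum_armMarginal_eq hT hz.1 hz.2
  have hHle : H ≤ characteristicFoot c T :=
    add_le_add hz.2.le (mul_le_mul_of_nonneg_left (hc.powSum_armMarginal_le hT hz.1 hz.2)
      (hc.clock_nonneg hT))
  have hconv : ConvexOn ℝ (Icc 0 1)
      (fun x => clock c T * powSum (armMarginal (c 0)) x - x) :=
    ((convexOn_powSum hc.armMarginal_initial_nonneg hc.summable_armMarginal_initial).smul
      (hc.clock_nonneg hT)).sub (concaveOn_id (convex_Icc 0 1))
  have h := hconv.le_on_segment ⟨hx, hxT.le.trans hfoot.2⟩ hfoot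
    (z := H) (by rw [segment_eq_Icc hxT.le]; exact ⟨hzx.le, hHle⟩)
  have e1 : clock c T * powSum (armMarginal (c 0)) H - H = -z := by
    rw [← hHeq, hH]; ring
  have e2 : clock c T * powSum (armMarginal (c 0)) (characteristicFoot c T) -
      characteristicFoot c T = -Real.exp (-T) := by
    rw [← hc.scaledArm_eq_powSum hT, characteristicFoot]; ring
  rw [e1, e2] at h
  have : -z ≤ -Real.exp (-T) := h.trans (max_le (by linarith) le_rfl)
  linarith [hz.2]

lemma gelationProfile (hc : IsModifiedSmoluchowskiSolution c c₀) :
    GelationProfile (armMarginal (c 0)) (scaledArm c) (characteristicFoot c) (clock c) where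
  coeff_nonneg := hc.armMarginal_initial_nonneg
  coeff_summable := hc.summable_armMarginal_initial
  w_pos _ ht := hc.scaledArm_pos ht
  w_anti _ _ hs hst := hc.exp_mul_arm_le hs hst
  w_eq _ ht := hc.scaledArm_eq_powSum ht
  foot_eq _ _ := rfl
  foot_le_one _ ht := (hc.characteristicFoot_mem ht).2
  clock_zero := by simp [clock]
  le_clock_sub _ _ hs hst := hc.le_clock_sub hs hst
  clock_sub_le _ _ hs hst := hc.clock_sub_le hs hst
  lt_of_lt_foot _ ht _ hx hxt := hc.phase_lt_of_lt_foot ht hx hxt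

/-- The total mass is the initial mass generating function at the characteristic foot. -/
lemma massSum_eq_powSum (hc : IsModifiedSmoluchowskiSolution c c₀) (hT : 0 ≤ T)
    (hsum : Summable fun p : ℕ × ℕ => (p.2 : ℝ) * c 0 p.1 p.2) :
    massSum (c T) = powSum (massMarginal (c 0)) (characteristicFoot c T) := by
  have hs0 : Summable (massMarginal (c 0)) := hsum.prod
  have hexp := Real.exp_pos (-T)
  have hfib : ∀ a m : ℕ, (m : ℝ) * c T a m = (m : ℝ) * lossless c T a m * Real.exp (-T) ^ a :=
    fun a m => by
      rw [lossless, Real.exp_neg, inv_pow]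
      field_simp
  have hmarg : ∀ a, ∑' m : ℕ, (m : ℝ) * c T a m =
      massMarginal (lossless c T) a * Real.exp (-T) ^ a := fun a => by
    rw [tsum_congr (hfib a), tsum_mul_right, massMarginal]
  have hs : Summable fun a => massMarginal (lossless c T) a * Real.exp (-T) ^ a := by
    refine summable_mul_pow_of_powSum_le (M := powSum (massMarginal (c 0)) 1)
      (hc.massMarginal_nonneg hT) hexp fun z hz hzT => ⟨?_, ?_⟩
    · have hr : z / Real.exp (-T) < 1 := (div_lt_one hexp).2 hzT
      refine Summable.of_nonneg_of_le
        (fun a => mul_nonneg (hc.massMarginal_nonneg hT a) (pow_nonneg hz.le a)) (fun a => ?_)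
        ((summable_geometric_of_lt_one (by positivity) hr).mul_left (massSum (c 0)))
      have := mul_le_mul_of_nonneg_right (hc.massMarginal_mul_pow_le hT hsum a)
        (pow_nonneg (div_nonneg hz.le hexp.le) a)
      rwa [mul_assoc, ← mul_pow, mul_div_cancel₀ _ hexp.ne'] at this
    · rw [hc.powSum_massMarginal_eq hT hz hzT hsum]
      have hmem := hc.line_mem hT hz hzT
      exact powSum_monotoneOn hc.massMarginal_initial_nonneg hs0 hmem ⟨zero_le_one, le_rfl⟩ hmem.2
  have h := tendsto_powSum_nhdsLT (hc.massMarginal_nonneg hT) hexp hs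
  have heq : powSum (massMarginal (lossless c T)) (Real.exp (-T)) =
      powSum (massMarginal (c 0)) (characteristicFoot c T) := by
    refine tendsto_nhds_unique h ((hc.tendsto_powSum_line hT hc.massMarginal_initial_nonneg
      hs0).congr' ?_)
    filter_upwards [Ioo_mem_nhdsLT hexp] with z hz
    exact (hc.powSum_massMarginal_eq hT hz.1 hz.2 hsum).symm
  have hsT : Summable fun p : ℕ × ℕ => (p.2 : ℝ) * c T p.1 p.2 := by
    rw [summable_prod_of_nonneg fun p => mul_nonneg p.2.cast_nonneg (hc.nonneg hT _ _)]
    refine ⟨fun a => ?_, ?_⟩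
    · exact ((hc.summable_mass_lossless hT hsum a).mul_right (Real.exp (-T) ^ a)).congr
        fun m => (hfib a m).symm
    · exact hs.congr fun a => (hmarg a).symm
  rw [massSum, hsT.tsum_prod, ← heq, powSum]
  exact tsum_congr hmarg

end IsModifiedSmoluchowskiSolution

section CriticalTime

variable {p : ℕ → ℝ}

lemma summable_and_tsum_eq_of_tsum_ofReal_ne_top (hp : ∀ k, 0 ≤ p k)
    (h : ∑' k : ℕ, ENNReal.ofReal (k * p k) ≠ ⊤) : (Summable fun k : ℕ => (k : ℝ) * p k) ∧
      (∑' k : ℕ, ENNReal.ofReal (k * p k)).toReal = ∑' k : ℕ, (k : ℝ) * p k := by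
  have h0 : ∀ k : ℕ, 0 ≤ (k : ℝ) * p k := fun k => mul_nonneg k.cast_nonneg (hp k)
  have hs : Summable fun k : ℕ => (k : ℝ) * p k :=
    (ENNReal.summable_toReal h).congr fun k => ENNReal.toReal_ofReal (h0 k)
  exact ⟨hs, by rw [← ENNReal.ofReal_tsum_of_nonneg h0 hs, ENNReal.toReal_ofReal (tsum_nonneg h0)]⟩

lemma neg_log_critical_nonneg {m₁ m₂ : ℝ} (h1 : 0 < m₁) (h12 : m₁ < m₂) :
    0 < 1 - m₁ / m₂ ∧ 0 ≤ -Real.log (1 - m₁ / m₂) := by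
  have h2 := h1.trans h12
  have h3 : m₁ / m₂ < 1 := (div_lt_one h2).2 h12
  have h4 : 0 < m₁ / m₂ := div_pos h1 h2
  exact ⟨by linarith, neg_nonneg.2 (Real.log_nonpos (by linarith) (by linarith))⟩

lemma le_log_critical_iff {m₁ m₂ t : ℝ} (h1 : 0 < m₁) (h12 : m₁ < m₂) :
    t ≤ -Real.log (1 - m₁ / m₂) ↔ m₂ * (1 - Real.exp (-t)) ≤ m₁ := by
  have h2 := h1.trans h12
  rw [le_neg, Real.log_le_iff_le_exp (neg_log_critical_nonneg h1 h12).1, sub_le_comm,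
    le_div_iff₀ h2, mul_comm]

end CriticalTime

section Initial

variable {c₀ : ℕ → ℕ → ℝ}

lemma tsum_armMarginal (h₀sum : Summable fun p : ℕ × ℕ => (p.1 : ℝ) * c₀ p.1 p.2) :
    ∑' i, armMarginal c₀ i = armSum c₀ := by
  have h := hasSum_armFlux h₀sum
  exact (h.prod_fiberwise fun i => (h.summable.prod_factor i).hasSum).tsum_eq

lemma armSum2_eq (h₀pos : ∀ a m, 0 ≤ c₀ a m)
    (h₀sum : Summable fun p : ℕ × ℕ => (p.1 : ℝ) * c₀ p.1 p.2) :
    armSum2 c₀ = ∑' i : ℕ, ENNReal.ofReal (i * armMarginal c₀ i) := by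
  have hs := (hasSum_armFlux h₀sum).summable.prod_factor
  rw [armSum2, ENNReal.tsum_prod (f := fun a m : ℕ =>
    ENNReal.ofReal ((a : ℝ) * ((a : ℝ) - 1) * c₀ a m)), tsum_eq_zero_add' ENNReal.summable]
  simp only [Nat.cast_zero, zero_mul, ENNReal.ofReal_zero, tsum_zero, zero_add]
  refine tsum_congr fun i => ?_
  rw [armMarginal, ← tsum_mul_left, ENNReal.ofReal_tsum_of_nonneg
    (fun m => mul_nonneg i.cast_nonneg (armFlux_nonneg h₀pos i m)) ((hs i).mul_left _)]
  refine tsum_congr fun m => ?_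
  simp only [armFlux]
  push_cast
  ring_nf

lemma exists_massMarginal_pos (h₀pos : ∀ a m, 0 ≤ c₀ a m) (h₀mass0 : ∀ a, c₀ a 0 = 0)
    (h₀arm : 0 < armSum c₀) (h₀msum : Summable fun p : ℕ × ℕ => (p.2 : ℝ) * c₀ p.1 p.2) :
    ∃ a, a ≠ 0 ∧ 0 < massMarginal c₀ a := by
  have hex : ∃ p : ℕ × ℕ, (p.1 : ℝ) * c₀ p.1 p.2 ≠ 0 := by
    by_contra! h
    simp [armSum, h] at h₀arm
  obtain ⟨⟨a, m⟩, h⟩ := hex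
  have ha : a ≠ 0 := fun h0 => h (by simp [h0])
  have hm : m ≠ 0 := fun h0 => h (by simp [h0, h₀mass0])
  have hc : 0 < c₀ a m := (h₀pos a m).lt_of_ne' fun h0 => h (by simp [h0])
  refine ⟨a, ha, lt_of_lt_of_le ?_ ((h₀msum.prod_factor a).le_tsum m fun k _ =>
    mul_nonneg k.cast_nonneg (h₀pos a k))⟩
  exact mul_pos (by exact_mod_cast Nat.pos_of_ne_zero hm) hc

end Initial

namespace GelationProfile

variable {c₀ : ℕ → ℕ → ℝ} {w ℓ α : ℝ → ℝ}

lemma foot_eq_one_of_le_Tgel (h : GelationProfile (armMarginal c₀) w ℓ α)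
    (h₀pos : ∀ a m, 0 ≤ c₀ a m) (h₀sum : Summable fun p : ℕ × ℕ => (p.1 : ℝ) * c₀ p.1 p.2)
    (h₀arm : 0 < armSum c₀) {t : ℝ} (ht : 0 ≤ t) (htg : ENNReal.ofReal t ≤ TgelSmolu c₀) :
    ℓ t = 1 := by
  have h2 := armSum2_eq h₀pos h₀sum
  by_cases htop : armSum2 c₀ = ⊤
  · simp only [TgelSmolu, htop, ENNReal.ofReal_lt_top, if_true, ENNReal.toReal_top, _root_.div_zero,
      sub_zero, Real.log_one, neg_zero, ENNReal.ofReal_zero, nonpos_iff_eq_zero,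
      ENNReal.ofReal_eq_zero] at htg
    rw [le_antisymm htg ht, h.foot_zero]
  obtain ⟨hs, hm⟩ := summable_and_tsum_eq_of_tsum_ofReal_ne_top h.coeff_nonneg (h2 ▸ htop)
  rw [← h2] at hm
  refine h.foot_eq_one ht hs ?_
  rw [tsum_armMarginal h₀sum, ← hm]
  by_cases hlt : ENNReal.ofReal (armSum c₀) < armSum2 c₀
  · have hlt' := (ENNReal.ofReal_lt_iff_lt_toReal h₀arm.le htop).1 hlt
    rw [TgelSmolu, if_pos hlt, ENNReal.ofReal_le_ofReal_iff
      (neg_log_critical_nonneg h₀arm hlt').2] at htg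
    exact (le_log_critical_iff h₀arm hlt').1 htg
  · have hle := ENNReal.toReal_le_of_le_ofReal h₀arm.le (not_lt.1 hlt)
    refine le_trans (mul_le_of_le_one_right ENNReal.toReal_nonneg ?_) hle
    linarith [Real.exp_pos (-t)]

lemma foot_lt_of_Tgel_le (h : GelationProfile (armMarginal c₀) w ℓ α)
    (h₀pos : ∀ a m, 0 ≤ c₀ a m) (h₀sum : Summable fun p : ℕ × ℕ => (p.1 : ℝ) * c₀ p.1 p.2)
    (h₀arm : 0 < armSum c₀) (htop : TgelSmolu c₀ ≠ ⊤) {s t : ℝ} (hs : (TgelSmolu c₀).toReal ≤ s)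
    (hst : s < t) : ℓ t < ℓ s := by
  have hs0 : 0 ≤ s := ENNReal.toReal_nonneg.trans hs
  refine (h.foot_anti hs0 hst.le).lt_of_ne fun heq => ?_
  obtain ⟨hsm, hle⟩ := h.subcritical_of_foot_eq hs0 hst heq.symm
  have h0 : ∀ k : ℕ, 0 ≤ (k : ℝ) * armMarginal c₀ k := fun k =>
    mul_nonneg k.cast_nonneg (h.coeff_nonneg k)
  have h2 := armSum2_eq h₀pos h₀sum
  rw [← ENNReal.ofReal_tsum_of_nonneg h0 hsm] at h2
  have hm : (armSum2 c₀).toReal = ∑' k : ℕ, (k : ℝ) * armMarginal c₀ k := by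
    rw [h2, ENNReal.toReal_ofReal (tsum_nonneg h0)]
  have hlt : ENNReal.ofReal (armSum c₀) < armSum2 c₀ := by
    by_contra hn
    exact htop (if_neg hn)
  have hlt' := (ENNReal.ofReal_lt_iff_lt_toReal h₀arm.le (by simp [h2])).1 hlt
  rw [TgelSmolu, if_pos hlt, ENNReal.toReal_ofReal (neg_log_critical_nonneg h₀arm hlt').2] at hs
  rw [tsum_armMarginal h₀sum, ← hm, ← le_log_critical_iff h₀arm hlt'] at hle
  linarith

end GelationProfile

/-- gelation for the modified Smoluchowski equation. -/
theorem stmt1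
    (c₀ : ℕ → ℕ → ℝ) (h₀pos : ∀ a m : ℕ, 0 ≤ c₀ a m) (h₀mass0 : ∀ a : ℕ, c₀ a 0 = 0)
    (h₀sum : Summable (fun p : ℕ × ℕ => (p.1 : ℝ) * c₀ p.1 p.2))
    (h₀arm : 0 < armSum c₀)
    (h₀msum : Summable (fun p : ℕ × ℕ => (p.2 : ℝ) * c₀ p.1 p.2))
    (c : ℝ → ℕ → ℕ → ℝ) (hc : IsModifiedSmoluchowskiSolution c c₀) :
    -- (1) the mass is continuous, constant before T_gel, strictly decreasing after
    (ContinuousOn (fun t => massSum (c t)) (Ici 0) ∧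
      (∀ t : ℝ, 0 ≤ t → ENNReal.ofReal t ≤ TgelSmolu c₀ → massSum (c t) = massSum c₀) ∧
      (TgelSmolu c₀ ≠ ⊤ →
        StrictAntiOn (fun t => massSum (c t)) (Ici (TgelSmolu c₀).toReal))) ∧
    -- (2) the number of arms is continuous, strictly decreasing and positive
    (ContinuousOn (fun t => armSum (c t)) (Ici 0) ∧
      StrictAntiOn (fun t => armSum (c t)) (Ici 0) ∧
      ∀ t ∈ Ici (0:ℝ), 0 < armSum (c t)) := by
  have h0 : c 0 = c₀ := hc.initial_eq h₀mass0
  have hprof := hc.gelationProfile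
  rw [h0] at hprof
  have hmem : ∀ t ∈ Ici (0:ℝ), characteristicFoot c t ∈ Icc (0:ℝ) 1 := fun t ht => hprof.foot_mem ht
  have hmass : ∀ t ∈ Ici (0:ℝ),
      massSum (c t) = powSum (massMarginal c₀) (characteristicFoot c t) := fun t ht => by
    rw [hc.massSum_eq_powSum ht (by rwa [h0]), h0]
  have harm : ∀ t ∈ Ici (0:ℝ), armSum (c t) =
      Real.exp (-t) * powSum (armMarginal c₀) (characteristicFoot c t) := fun t ht => by
    rw [← hprof.w_eq t ht, scaledArm, ← mul_assoc, ← Real.exp_add, neg_add_cancel, Real.exp_zero,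
      one_mul]
  have he0 : ∀ a, 0 ≤ massMarginal c₀ a := h0 ▸ hc.massMarginal_initial_nonneg
  have hes : Summable (massMarginal c₀) := h₀msum.prod
  refine ⟨⟨?_, fun t ht htg => ?_, fun htop s hs t ht hst => ?_⟩, ?_, fun s hs t ht hst => ?_,
    fun t ht => hc.arm_pos ht⟩
  · exact ((continuousOn_powSum he0 hes).comp hprof.continuousOn_foot hmem).congr hmass
  · rw [hmass t ht, hprof.foot_eq_one_of_le_Tgel h₀pos h₀sum h₀arm ht htg, powSum_one, massSum,
      h₀msum.tsum_prod]
    rfl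
  · have hs' : s ∈ Ici (0:ℝ) := ENNReal.toReal_nonneg.trans hs
    have ht' : t ∈ Ici (0:ℝ) := ENNReal.toReal_nonneg.trans ht
    obtain ⟨a, ha, hpos⟩ := exists_massMarginal_pos h₀pos h₀mass0 h₀arm h₀msum
    simp only [hmass s hs', hmass t ht']
    exact powSum_strictMonoOn he0 hes ha hpos (hmem t ht') (hmem s hs')
      (hprof.foot_lt_of_Tgel_le h₀pos h₀sum h₀arm htop hs hst)
  · exact ((Real.continuous_exp.comp continuous_neg).continuousOn.mul
      ((continuousOn_powSum hprof.coeff_nonneg hprof.coeff_summable).comp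
        hprof.continuousOn_foot hmem)).congr harm
  · simp only [harm s hs, harm t ht, ← hprof.w_eq s hs, ← hprof.w_eq t ht]
    exact mul_lt_mul (Real.exp_lt_exp.2 (neg_lt_neg hst)) (hprof.w_anti s t hs hst.le)
      (hprof.w_pos t ht) (Real.exp_pos _).le
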